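/- arXiv:1305.7112 — 2 statements merged into one kernel-verified Lean document; each statement's English description precedes it below -/
import Mathlib

section
/- Let n ≥ 1 be an integer, let T be a tree on n vertices, and let G be a finite simple graph. If tw(G) ≥ 3n − 1, then there exists a graph H ∈ Λ(T) such that H is a minor of G. -/
/-- `IsMinor H G` : there is a minor model of `H` in `G`. -/
def IsMinor {α : Type*} {β : Type*} (H : SimpleGraph α) (G : SimpleGraph β) : Prop :=
  ∃ M : α → Set β,
    (∀ v, (G.induce (M v)).Connected) ∧
    (Pairwise fun u v => Disjoint (M u) (M v)) ∧
    (∀ ⦃u v : α⦄, H.Adj u v → ∃ a ∈ M u, ∃ b ∈ M v, G.Adj a b)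

/-- The treewidth of a finite simple graph: the least `w` such that `G` admits a tree
decomposition all of whose bags have at most `w + 1` vertices. -/
noncomputable def treewidth {V : Type*} [Fintype V] (G : SimpleGraph V) : ℕ :=
  sInf { w : ℕ | ∃ (ι : Type) (_ : Fintype ι) (t : SimpleGraph ι) (bag : ι → Finset V),
    t.IsTree ∧
    (∀ v : V, ∃ i, v ∈ bag i) ∧
    (∀ u v : V, G.Adj u v → ∃ i, u ∈ bag i ∧ v ∈ bag i) ∧
    (∀ v : V, (t.induce {i : ι | v ∈ bag i}).Connected) ∧
    (∀ i, (bag i).card ≤ w + 1) }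

/-- A vertex is a leaf of a graph if it has exactly one neighbour (degree 1). -/
def IsLeaf {V : Type*} (T : SimpleGraph V) (v : V) : Prop := ∃! u, T.Adj v u

/-- The graph obtained from the disjoint union of a graph `T`, a path on `p` vertices
(the vertices `inr (some i)`) and an extra vertex `v_new` (the vertex `inr none`) by
adding an edge between `v_new` and every vertex of the path, and the `p` pairwise
disjoint edges `{path vertex i, m i}` where `m : Fin p → V`. -/
def lambdaGraph {V : Type*} (T : SimpleGraph V) (p : ℕ) (m : Fin p → V) :
    SimpleGraph (V ⊕ Option (Fin p)) :=
  SimpleGraph.fromRel (fun u v =>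
    match u, v with
    | Sum.inl a, Sum.inl b => T.Adj a b
    | Sum.inr (some i), Sum.inr (some j) => (j : ℕ) = (i : ℕ) + 1
    | Sum.inr none, Sum.inr (some _) => True
    | Sum.inl a, Sum.inr (some i) => m i = a
    | _, _ => False)

section Connectivity

variable {W : Type*} {G : SimpleGraph W}

/-- A set closed under adjacency inside a connected set `S` contains `S`. -/
theorem subset_of_connected_of_closed {S R : Set W} (h : (G.induce S).Connected) {a : W}
    (ha : a ∈ S) (haR : a ∈ R) (hR : ∀ x ∈ R, x ∈ S → ∀ y ∈ S, G.Adj x y → y ∈ R) : S ⊆ R := by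
  intro y hy
  have hr := h.preconnected ⟨a, ha⟩ ⟨y, hy⟩
  rw [SimpleGraph.reachable_iff_reflTransGen] at hr
  have key : ∀ z : S, Relation.ReflTransGen (G.induce S).Adj ⟨a, ha⟩ z → z.1 ∈ R := by
    intro z hz
    induction hz with
    | refl => exact haR
    | tail _ hbc ih => exact hR _ ih (Subtype.property _) _ (Subtype.property _) hbc
  exact key _ hr

theorem connected_of_forall_closed {S : Set W} {a : W} (ha : a ∈ S)
    (h : ∀ R : Set W, a ∈ R → (∀ x ∈ R, x ∈ S → ∀ y ∈ S, G.Adj x y → y ∈ R) → S ⊆ R) :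
    (G.induce S).Connected := by
  rw [SimpleGraph.connected_iff_exists_forall_reachable]
  refine ⟨⟨a, ha⟩, ?_⟩
  have := h {y | ∃ hy : y ∈ S, (G.induce S).Reachable ⟨a, ha⟩ ⟨y, hy⟩} ⟨ha, .refl _⟩ (by
    rintro x ⟨hx, hr⟩ _ y hy hxy
    exact ⟨hy, hr.trans (SimpleGraph.Adj.reachable (by simpa using hxy))⟩)
  rintro ⟨y, hy⟩
  exact (this hy).2

theorem connected_singleton (a : W) : (G.induce ({a} : Set W)).Connected :=
  connected_of_forall_closed (a := a) rfl fun R haR _ => by simpa using haR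

theorem connected_union {S T : Set W} (hS : (G.induce S).Connected) (hT : (G.induce T).Connected)
    {a b : W} (ha : a ∈ S) (hb : b ∈ T) (hab : a = b ∨ G.Adj a b) :
    (G.induce (S ∪ T)).Connected := by
  refine connected_of_forall_closed (a := a) (Or.inl ha) fun R haR hR => ?_
  have hSR : S ⊆ R := subset_of_connected_of_closed hS ha haR fun x hx hxS y hy hxy =>
    hR x hx (Or.inl hxS) y (Or.inl hy) hxy
  have hbR : b ∈ R := by
    rcases hab with rfl | hab
    · exact haR
    · exact hR a haR (Or.inl ha) b (Or.inr hb) hab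
  exact Set.union_subset hSR (subset_of_connected_of_closed hT hb hbR fun x hx hxS y hy hxy =>
    hR x hx (Or.inr hxS) y (Or.inr hy) hxy)

theorem connected_insert {S : Set W} (hS : (G.induce S).Connected) {a b : W} (ha : a ∈ S)
    (hab : G.Adj a b) : (G.induce (insert b S)).Connected := by
  have := connected_union hS (connected_singleton (G := G) b) ha rfl (Or.inr hab)
  rwa [Set.union_singleton] at this

theorem connected_biUnion {ι : Type*} {Q : SimpleGraph ι} {J : Set ι} {P : ι → Set W}
    (hJ : (Q.induce J).Connected) (hP : ∀ i ∈ J, (G.induce (P i)).Connected)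
    (hQ : ∀ i ∈ J, ∀ j ∈ J, Q.Adj i j → ∃ a ∈ P i, ∃ b ∈ P j, a = b ∨ G.Adj a b) :
    (G.induce (⋃ i ∈ J, P i)).Connected := by
  obtain ⟨⟨i, hi⟩⟩ := hJ.nonempty
  obtain ⟨⟨a, ha⟩⟩ := (hP i hi).nonempty
  refine connected_of_forall_closed (a := a) (Set.mem_biUnion hi ha) fun R haR hR => ?_
  have hcl : ∀ j ∈ J, ∀ b ∈ P j, b ∈ R → P j ⊆ R := fun j hj b hb hbR =>
    subset_of_connected_of_closed (hP j hj) hb hbR fun x hx hxS y hy hxy =>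
      hR x hx (Set.mem_biUnion hj hxS) y (Set.mem_biUnion hj hy) hxy
  have := subset_of_connected_of_closed (R := {j | P j ⊆ R}) hJ hi (hcl i hi a ha haR) (by
    intro j hjR hj l hl hjl
    obtain ⟨b, hb, c, hc, hbc⟩ := hQ j hj l hl hjl
    refine hcl l hl c hc ?_
    rcases hbc with rfl | hbc
    · exact hjR hb
    · exact hR b (hjR hb) (Set.mem_biUnion hj hb) c (Set.mem_biUnion hl hc) hbc)
  exact Set.iUnion₂_subset fun j hj => this hj

theorem connected_mono {G' : SimpleGraph W} (hle : G' ≤ G) {S : Set W}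
    (h : (G'.induce S).Connected) : (G.induce S).Connected :=
  h.mono fun _ _ hab => hle hab

/-- The connected component of `a` inside the set `S`. -/
theorem exists_component {S : Set W} {a : W} (ha : a ∈ S) :
    ∃ C ⊆ S, a ∈ C ∧ (G.induce C).Connected ∧ ∀ x ∈ C, ∀ y ∈ S, G.Adj x y → y ∈ C := by
  let C : Set W := {y | Relation.ReflTransGen (fun x y => G.Adj x y ∧ y ∈ S) a y}
  have hCS : C ⊆ S := by
    intro y hy
    rcases Relation.ReflTransGen.cases_tail hy with rfl | ⟨z, -, hz⟩
    · exact ha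
    · exact hz.2
  refine ⟨C, hCS, .refl, ?_, fun x hx y hy hxy => Relation.ReflTransGen.tail hx ⟨hxy, hy⟩⟩
  refine connected_of_forall_closed (a := a) .refl fun R haR hR y hy => ?_
  have hy' : Relation.ReflTransGen (fun x y => G.Adj x y ∧ y ∈ S) a y := hy
  clear hy
  induction hy' with
  | refl => exact haR
  | tail hab hbc ih => exact hR _ ih hab _ (hab.tail hbc) hbc.1

/-- In a connected set containing `a ≠ s`, there is a connected set avoiding `s` that contains `a`
and a neighbour of `s`. -/
theorem exists_connected_avoiding {S : Set W} (hS : (G.induce S).Connected) {a s : W} (ha : a ∈ S)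
    (hs : s ∈ S) (has : a ≠ s) :
    ∃ C ⊆ S \ {s}, a ∈ C ∧ (G.induce C).Connected ∧ ∃ c ∈ C, G.Adj c s := by
  obtain ⟨C, hCS, haC, hC, hcl⟩ := exists_component (G := G) (S := S \ {s}) (a := a) ⟨ha, has⟩
  refine ⟨C, hCS, haC, hC, ?_⟩
  by_contra! hno
  have := subset_of_connected_of_closed (R := C) hS ha haC (by
    intro x hx _ y hy hxy
    refine hcl x hx y ⟨hy, ?_⟩ hxy
    rintro rfl
    exact hno x hx hxy)
  exact (hCS (this hs)).2 rfl

end Connectivity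

section Menger

variable {W : Type*}

/-- `K` separates `A` from `B`; the set `R` is the side of `A`. -/
def SeparatesVia (G : SimpleGraph W) (A B K R : Set W) : Prop :=
  A ⊆ R ∪ K ∧ Disjoint R K ∧ Disjoint R B ∧ ∀ x ∈ R, ∀ y, G.Adj x y → y ∈ R ∪ K

theorem SeparatesVia.symm {G : SimpleGraph W} {A B K R : Set W} (h : SeparatesVia G A B K R) :
    SeparatesVia G B A K (R ∪ K)ᶜ := by
  obtain ⟨h1, h2, h3, h4⟩ := h
  refine ⟨fun b hb => ?_, ?_, ?_, fun x hx y hxy => ?_⟩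
  · by_cases hbK : b ∈ K
    · exact Or.inr hbK
    · exact Or.inl fun hb' => hb'.elim (fun hbR => Set.disjoint_left.1 h3 hbR hb) hbK
  · exact Set.disjoint_left.2 fun x hx hxK => hx (Or.inr hxK)
  · exact Set.disjoint_left.2 fun x hx hxA => hx (h1 hxA)
  · by_cases hyK : y ∈ K
    · exact Or.inr hyK
    · exact Or.inl fun hy => hy.elim (fun hyR => hx (h4 y hyR x hxy.symm)) hyK

/-- There are `k` pairwise disjoint connected sets meeting both `A` and `B`. -/
def Linked (G : SimpleGraph W) (A B : Finset W) (k : ℕ) : Prop :=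
  ∃ (J : Finset W) (P : W → Set W), J.card = k ∧
    (∀ j ∈ J, (G.induce (P j)).Connected ∧ (∃ a ∈ P j, a ∈ A) ∧ ∃ b ∈ P j, b ∈ B) ∧
    ∀ i ∈ J, ∀ j ∈ J, i ≠ j → Disjoint (P i) (P j)

theorem Linked.symm {G : SimpleGraph W} {A B : Finset W} {k : ℕ} (h : Linked G A B k) :
    Linked G B A k := by
  obtain ⟨J, P, h1, h2, h3⟩ := h
  exact ⟨J, P, h1, fun j hj => ⟨(h2 j hj).1, (h2 j hj).2.2, (h2 j hj).2.1⟩, h3⟩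

/-- If the linkage has as many members as `B` has vertices, it may be indexed by `B`. -/
theorem Linked.exists_indexed {G : SimpleGraph W} {A B : Finset W} {k : ℕ} (h : Linked G A B k)
    (hB : B.card = k) :
    ∃ P : W → Set W,
      (∀ b ∈ B, (G.induce (P b)).Connected ∧ (∃ a ∈ P b, a ∈ A) ∧ b ∈ P b ∧
        ∀ b' ∈ B, b' ∈ P b → b' = b) ∧
      ∀ b ∈ B, ∀ b' ∈ B, b ≠ b' → Disjoint (P b) (P b') := by
  obtain ⟨J, P, hJ, hP, hdis⟩ := h
  choose! f hfP hfB using fun j hj => (hP j hj).2.2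
  have hinj : Set.InjOn f J := by
    intro i hi j hj hij
    by_contra hne
    exact Set.disjoint_left.1 (hdis i hi j hj hne) (hfP i hi) (hij ▸ hfP j hj)
  have hsurj : ∀ b ∈ B, ∃ j ∈ J, f j = b := fun b hb =>
    Finset.surjOn_of_injOn_of_card_le f hfB hinj (by omega) hb
  choose! g hgJ hfg using hsurj
  refine ⟨fun b => P (g b), fun b hb => ?_, fun b hb b' hb' hne => ?_⟩
  · have hg := hgJ b hb
    refine ⟨(hP _ hg).1, (hP _ hg).2.1, ?_, fun b' hb' hbb' => ?_⟩
    · have := hfP _ hg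
      rwa [hfg b hb] at this
    · have h1 := hfP _ (hgJ b' hb')
      rw [hfg b' hb'] at h1
      by_contra hne
      have hgne : g b' ≠ g b := fun he => hne (by rw [← hfg b' hb', he, hfg b hb])
      exact Set.disjoint_left.1 (hdis _ (hgJ b' hb') _ hg hgne) h1 hbb'
  · exact hdis _ (hgJ b hb) _ (hgJ b' hb') fun he => hne (by rw [← hfg b hb, he, hfg b' hb'])

theorem Linked.mono {G G' : SimpleGraph W} (hle : G' ≤ G) {A B : Finset W} {k : ℕ}
    (h : Linked G' A B k) : Linked G A B k := by
  obtain ⟨J, P, h1, h2, h3⟩ := h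
  exact ⟨J, P, h1, fun j hj => ⟨connected_mono hle (h2 j hj).1, (h2 j hj).2⟩, h3⟩

/-- One half of the inductive step in Menger's theorem: a linkage from `A` to the separator
`insert x S` that stays on the side of `A`. -/
theorem exists_linkage_to_separator [DecidableEq W] {G G' : SimpleGraph W} {A B S : Finset W}
    {R : Set W} {x y : W} {k : ℕ} (hle : G' ≤ G)
    (hdel : ∀ u v, G.Adj u v → ¬ G'.Adj u v → s(u, v) = s(x, y))
    (ih : ∀ A B : Finset W,
      (∀ (K : Finset W) (R : Set W), SeparatesVia G' A B K R → k ≤ K.card) → Linked G' A B k)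
    (hG : ∀ (K : Finset W) (R : Set W), SeparatesVia G A B K R → k ≤ K.card)
    (hR : SeparatesVia G' A B S R) (hx : x ∈ R) (hy : y ∉ R) (hS : S.card < k) :
    (insert x S).card = k ∧ ∃ P : W → Set W,
      (∀ s ∈ insert x S, (G.induce (P s)).Connected ∧ (∃ a ∈ P s, a ∈ A) ∧ s ∈ P s ∧
        P s ⊆ insert s R) ∧
      ∀ s ∈ insert x S, ∀ s' ∈ insert x S, s ≠ s' → Disjoint (P s) (P s') := by
  obtain ⟨h1, h2, h3, h4⟩ := hR
  have hstep : ∀ z ∈ R, z ≠ x → ∀ w, G.Adj z w → w ∈ R ∪ (S : Set W) := by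
    intro z hz hzx w hzw
    by_cases hG' : G'.Adj z w
    · exact h4 z hz w hG'
    · have := hdel z w hzw hG'
      rw [Sym2.eq_iff] at this
      rcases this with ⟨rfl, -⟩ | ⟨rfl, -⟩
      · exact absurd rfl hzx
      · exact absurd hz hy
  have hcard : (insert x S).card = k := by
    apply le_antisymm
    · exact (Finset.card_insert_le _ _).trans hS
    · refine hG _ (R \ {x}) ⟨fun a ha => ?_, ?_, h3.mono_left Set.sdiff_subset, fun z hz w hzw => ?_⟩
      · rcases h1 ha with h | h
        · by_cases hax : a = x
          · right; simp [hax]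
          · exact Or.inl ⟨h, hax⟩
        · right; simp at h; simp [h]
      · rw [Set.disjoint_left]
        intro z hz hz'
        simp only [Finset.coe_insert, Set.mem_insert_iff] at hz'
        rcases hz' with hz' | hz'
        · exact hz.2 hz'
        · exact Set.disjoint_left.1 h2 hz.1 hz'
      · by_cases hwx : w = x
        · right; simp [hwx]
        · rcases hstep z hz.1 hz.2 w hzw with h | h
          · exact Or.inl ⟨h, hwx⟩
          · right; simp at h; simp [h]
  refine ⟨hcard, ?_⟩
  have hlink : Linked G' A (insert x S) k := by
    refine ih _ _ fun K R₁ ⟨k1, k2, k3, k4⟩ => ?_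
    have hnx : x ∉ R₁ := fun h => Set.disjoint_left.1 k3 h (by simp)
    have hnS : ∀ w ∈ R₁, w ∉ S := fun w h h' => Set.disjoint_left.1 k3 h (by simp [h'])
    refine hG K (R₁ ∩ R) ⟨fun a ha => ?_, k2.mono_left Set.inter_subset_left,
      h3.mono_left Set.inter_subset_right, fun z hz w hzw => ?_⟩
    · rcases k1 ha with h | h
      · refine Or.inl ⟨h, ?_⟩
        rcases h1 ha with h' | h'
        · exact h'
        · exact absurd h' (hnS a h)
      · exact Or.inr h
    · have hzx : z ≠ x := fun h => hnx (h ▸ hz.1)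
      have hzw' : G'.Adj z w := by
        by_contra hG'
        have := hdel z w hzw hG'
        rw [Sym2.eq_iff] at this
        rcases this with ⟨h, -⟩ | ⟨h, -⟩
        · exact hzx h
        · exact hy (h ▸ hz.2)
      rcases k4 z hz.1 w hzw' with h | h
      · refine Or.inl ⟨h, ?_⟩
        rcases h4 z hz.2 w hzw' with h' | h'
        · exact h'
        · exact absurd h' (hnS w h)
      · exact Or.inr h
  obtain ⟨P, hP, hdis⟩ := hlink.exists_indexed hcard
  have htrim : ∀ s ∈ insert x S, ∃ C ⊆ P s, (G.induce C).Connected ∧ (∃ a ∈ C, a ∈ A) ∧ s ∈ C ∧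
      C ⊆ insert s R := by
    intro s hs
    obtain ⟨hc, ⟨a, haP, haA⟩, hsP, huniq⟩ := hP s hs
    by_cases has : a = s
    · subst has
      exact ⟨{a}, by simpa using haP, connected_singleton a, ⟨a, rfl, haA⟩, rfl, by simp⟩
    · obtain ⟨C, hCP, haC, hC, c, hcC, hcs⟩ := exists_connected_avoiding hc haP hsP has
      have hCS : ∀ z ∈ C, z ∉ insert x S := fun z hz hz' =>
        (hCP hz).2 (huniq z hz' (hCP hz).1)
      refine ⟨insert s C, ?_, connected_mono hle (connected_insert hC hcC hcs),
        ⟨a, Or.inr haC, haA⟩, Or.inl rfl, Set.insert_subset_insert ?_⟩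
      · exact Set.insert_subset hsP (hCP.trans Set.sdiff_subset)
      · have haR : a ∈ R := by
          rcases h1 haA with h | h
          · exact h
          · exact absurd (Finset.mem_insert_of_mem h) (hCS a haC)
        refine subset_of_connected_of_closed hC haC haR fun z hz _ w hw hzw => ?_
        rcases h4 z hz w hzw with h | h
        · exact h
        · exact absurd (Finset.mem_insert_of_mem h) (hCS w hw)
  choose! Q hQP hQ using htrim
  exact ⟨Q, hQ, fun s hs s' hs' hne => (hdis s hs s' hs' hne).mono (hQP s hs) (hQP s' hs')⟩

/-- **Menger's theorem** for vertex sets. -/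
theorem linked_of_forall_separatesVia [Finite W] [DecidableEq W] (k : ℕ) (G : SimpleGraph W) (A B : Finset W)
    (hG : ∀ (K : Finset W) (R : Set W), SeparatesVia G A B K R → k ≤ K.card) :
    Linked G A B k := by
  induction hm : G.edgeSet.ncard using Nat.strong_induction_on generalizing G A B with
  | _ m ih =>
  by_cases hE : G.edgeSet = ∅
  · have hno : ∀ u v, ¬ G.Adj u v := fun u v h => by
      have : s(u, v) ∈ G.edgeSet := h
      simp [hE] at this
    have : k ≤ (A ∩ B).card := by
      refine hG _ (A \ B : Set W) ⟨fun a ha => ?_, ?_, ?_, fun x _ y hxy => absurd hxy (hno x y)⟩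
      · by_cases h : a ∈ B
        · right; simpa using ⟨ha, h⟩
        · exact Or.inl ⟨ha, h⟩
      · rw [Set.disjoint_left]; intro z hz hz'; simp at hz'; exact hz.2 hz'.2
      · exact Set.disjoint_left.2 fun z hz hz' => hz.2 hz'
    obtain ⟨J, hJ, hJk⟩ := Finset.exists_subset_card_eq this
    refine ⟨J, fun j => {j}, hJk, fun j hj => ?_, fun i _ j _ hij => by simpa using hij⟩
    have := Finset.mem_inter.1 (hJ hj)
    exact ⟨connected_singleton j, ⟨j, rfl, this.1⟩, ⟨j, rfl, this.2⟩⟩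
  obtain ⟨e, he⟩ := Set.nonempty_iff_ne_empty.2 hE
  set G' := G.deleteEdges {e} with hG'
  have hle : G' ≤ G := SimpleGraph.deleteEdges_le _
  have hdel : ∀ u v, G.Adj u v → ¬ G'.Adj u v → s(u, v) = e := by
    intro u v huv h
    by_contra hne
    exact h (by rw [hG', SimpleGraph.deleteEdges_adj]; exact ⟨huv, hne⟩)
  have hlt : G'.edgeSet.ncard < m := by
    rw [← hm, hG', SimpleGraph.edgeSet_deleteEdges]
    exact Set.ncard_sdiff_singleton_lt_of_mem he
  have ih' : ∀ A B : Finset W,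
      (∀ (K : Finset W) (R : Set W), SeparatesVia G' A B K R → k ≤ K.card) → Linked G' A B k :=
    fun A B h => ih _ hlt G' A B h rfl
  by_cases hsep : ∀ (K : Finset W) (R : Set W), SeparatesVia G' A B K R → k ≤ K.card
  · exact (ih' A B hsep).mono hle
  push Not at hsep
  obtain ⟨S, R, hR, hS⟩ := hsep
  have hnot : ∃ x ∈ R, ∃ y, G.Adj x y ∧ y ∉ R ∧ y ∉ S := by
    by_contra! h
    refine absurd (hG S R ⟨hR.1, hR.2.1, hR.2.2.1, fun x hx y hxy => ?_⟩) (by omega)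
    by_cases hy : y ∈ R
    · exact Or.inl hy
    · exact Or.inr (h x hx y hxy hy)
  obtain ⟨x, hx, y, hxy, hyR, hyS⟩ := hnot
  have hexy : e = s(x, y) := by
    refine (hdel x y hxy fun h => ?_).symm
    rcases hR.2.2.2 x hx y h with h' | h'
    · exact hyR h'
    · exact hyS h'
  have hxS : x ∉ S := fun h => Set.disjoint_left.1 hR.2.1 hx h
  obtain ⟨hcard, P, hP, hPdis⟩ := exists_linkage_to_separator hle
    (fun u v h h' => (hdel u v h h').trans hexy) ih' hG hR hx hyR hS
  obtain ⟨-, Q, hQ, hQdis⟩ := exists_linkage_to_separator (x := y) (y := x) hle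
    (fun u v h h' => (hdel u v h h').trans (hexy.trans Sym2.eq_swap)) ih'
    (fun K R h => hG K _ h.symm) hR.symm (by simp [hyR, hyS]) (by simp [hx]) hS
  let g : W → W := fun s => if s = x then y else s
  have hg : ∀ s ∈ insert x S, g s ∈ insert y S ∧ g s ∉ R := by
    intro s hs
    by_cases h : s = x
    · simp [g, h, hyR]
    · have hsS : s ∈ S := by simpa [h] using hs
      simp only [g, h, if_false]
      exact ⟨by simp [hsS], fun h' => Set.disjoint_left.1 hR.2.1 h' hsS⟩
  have hginj : ∀ s ∈ insert x S, ∀ s' ∈ insert x S, s ≠ s' → s ≠ g s' ∧ g s ≠ g s' := by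
    intro s hs s' hs' hne
    have hxy' : x ≠ y := hxy.ne
    have e1 : s ≠ y := by
      rintro rfl
      rcases Finset.mem_insert.1 hs with h | h
      · exact hxy' h.symm
      · exact hyS h
    have e2 : s' ≠ y := by
      rintro rfl
      rcases Finset.mem_insert.1 hs' with h | h
      · exact hxy' h.symm
      · exact hyS h
    have e3 : g s = if s = x then y else s := rfl
    have e4 : g s' = if s' = x then y else s' := rfl
    rw [e3, e4]
    by_cases h : s = x <;> by_cases h' : s' = x
    · exact absurd (h.trans h'.symm) hne
    · rw [if_pos h, if_neg h']
      exact ⟨hne, e2.symm⟩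
    · rw [if_neg h, if_pos h']
      exact ⟨e1, e1⟩
    · rw [if_neg h, if_neg h']
      exact ⟨hne, hne⟩
  have hcross : ∀ s ∈ insert x S, ∀ s' ∈ insert x S, s ≠ s' → Disjoint (P s) (Q (g s')) := by
    intro s hs s' hs' hne
    refine Disjoint.mono (hP s hs).2.2.2 (hQ _ (hg s' hs').1).2.2.2 ?_
    rw [Set.disjoint_left]
    rintro z (rfl | hz) (hz' | hz')
    · exact (hginj z hs s' hs' hne).1 hz'
    · rcases Finset.mem_insert.1 hs with h | h
      · exact hz' (Or.inl (h ▸ hx))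
      · exact hz' (Or.inr h)
    · exact (hg s' hs').2 (hz' ▸ hz)
    · exact hz' (Or.inl hz)
  refine ⟨insert x S, fun s => P s ∪ Q (g s), hcard, fun s hs => ?_, fun s hs s' hs' hne => ?_⟩
  · obtain ⟨p1, ⟨a, ha, haA⟩, p3, -⟩ := hP s hs
    obtain ⟨q1, ⟨b, hb, hbB⟩, q3, -⟩ := hQ _ (hg s hs).1
    refine ⟨connected_union p1 q1 p3 q3 ?_, ⟨a, Or.inl ha, haA⟩, ⟨b, Or.inr hb, hbB⟩⟩
    by_cases h : s = x
    · right; simpa [g, h] using hxy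
    · left; simp [g, h]
  · rw [Set.disjoint_union_left, Set.disjoint_union_right, Set.disjoint_union_right]
    exact ⟨⟨hPdis s hs s' hs' hne, hcross s hs s' hs' hne⟩, (hcross s' hs' s hs hne.symm).symm,
      hQdis _ (hg s hs).1 _ (hg s' hs').1 (hginj s hs s' hs' hne).2⟩

end Menger


section Tree

variable {W : Type*} {G : SimpleGraph W}

theorem connected_image_embedding {V : Type*} {H : SimpleGraph V} {f : V → W}
    (hf : ∀ a b, H.Adj a b → G.Adj (f a) (f b)) {S : Set V} (hS : (H.induce S).Connected) :
    (G.induce (f '' S)).Connected := by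
  have := connected_biUnion (G := G) (P := fun i => {f i}) hS
    (fun i _ => connected_singleton (f i)) (fun i _ j _ hij => ⟨_, rfl, _, rfl, Or.inr (hf i j hij)⟩)
  have h : f '' S = ⋃ i ∈ S, {f i} := by
    ext x
    simp [eq_comm]
  rwa [h]

theorem exists_minimal_connected_of_isTree {ι : Type*} {t : SimpleGraph ι} (ht : t.IsTree)
    (s j : ι) : ∃ A : Set ι, s ∈ A ∧ j ∈ A ∧ (t.induce A).Connected ∧
      ∀ C : Set ι, (t.induce C).Connected → s ∈ C → j ∈ C → A ⊆ C := by
  classical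
  obtain ⟨p⟩ := ht.connected.preconnected s j
  refine ⟨{v | v ∈ p.bypass.support}, by simp, by simp, p.bypass.connected_induce_support, ?_⟩
  intro C hC hs hj v hv
  obtain ⟨q⟩ := hC.preconnected ⟨s, hs⟩ ⟨j, hj⟩
  set q' := q.map (SimpleGraph.Embedding.induce C).toHom with hq'
  have h1 : ∀ v ∈ q'.support, v ∈ C := by
    intro v hv
    rw [hq', SimpleGraph.Walk.support_map, List.mem_map] at hv
    obtain ⟨w, -, rfl⟩ := hv
    exact w.2
  have h2 : (⟨p.bypass, p.bypass_isPath⟩ : t.Path s j) = ⟨q'.bypass, q'.bypass_isPath⟩ :=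
    (ht.isAcyclic.subsingleton_path s j).elim _ _
  have h3 : p.bypass = q'.bypass := congrArg Subtype.val h2
  refine h1 v (q'.support_bypass_subset_support ?_)
  rw [← h3]; exact hv

theorem IsTree.sum_sup_edge {ι κ : Type*} [Finite ι] [Finite κ] {t : SimpleGraph ι}
    {u : SimpleGraph κ} (ht : t.IsTree) (hu : u.IsTree) (a : ι) (b : κ) :
    (SimpleGraph.sum t u ⊔ SimpleGraph.edge (Sum.inl a) (Sum.inr b)).IsTree := by
  classical
  have := Fintype.ofFinite ι
  have := Fintype.ofFinite κ
  rw [SimpleGraph.isTree_iff_connected_and_card] at ht hu ⊢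
  refine ⟨ht.1.sum_sup_edge hu.1, ?_⟩
  have h := SimpleGraph.card_edgeFinset_sup_edge (G := SimpleGraph.sum t u) (s := Sum.inl a)
    (t := Sum.inr b) (by simp) (by simp)
  rw [Nat.card_eq_fintype_card, ← SimpleGraph.edgeFinset_card, h, SimpleGraph.edgeFinset_card,
    Fintype.card_congr SimpleGraph.edgeSetSumEquiv, Fintype.card_sum, Nat.card_eq_fintype_card,
    Fintype.card_sum]
  have h1 := ht.2
  have h2 := hu.2
  rw [Nat.card_eq_fintype_card, Nat.card_eq_fintype_card] at h1 h2
  omega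

end Tree

section TreeDecomposition

variable {W : Type*} {G : SimpleGraph W}

/-- A tree decomposition, indexed by the tree `t`, of the subgraph of `G` induced by `S`. -/
structure IsTreeDecomposition (G : SimpleGraph W) (S : Finset W) {ι : Type} (t : SimpleGraph ι)
    (bag : ι → Finset W) : Prop where
  isTree : t.IsTree
  bag_subset : ∀ i, bag i ⊆ S
  exists_bag_of_adj : ∀ u ∈ S, ∀ v ∈ S, G.Adj u v → ∃ i, u ∈ bag i ∧ v ∈ bag i
  connected : ∀ v ∈ S, (t.induce {i | v ∈ bag i}).Connected

/-- `G.induce S` has a tree decomposition with all bags satisfying `Q`, one of them being `X`. -/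
def HasDecomposition (G : SimpleGraph W) (S : Finset W) (Q : Finset W → Prop) (X : Finset W) :
    Prop :=
  ∃ (ι : Type) (_ : Fintype ι) (t : SimpleGraph ι) (bag : ι → Finset W),
    IsTreeDecomposition G S t bag ∧ (∀ i, Q (bag i)) ∧ ∃ s, bag s = X

theorem IsTreeDecomposition.exists_mem_bag {S : Finset W} {ι : Type} {t : SimpleGraph ι}
    {bag : ι → Finset W} (h : IsTreeDecomposition G S t bag) {v : W} (hv : v ∈ S) :
    ∃ i, v ∈ bag i := by
  obtain ⟨⟨i, hi⟩⟩ := (h.connected v hv).nonempty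
  exact ⟨i, hi⟩

theorem hasDecomposition_self {Q : Finset W → Prop} {X : Finset W} (hX : Q X) :
    HasDecomposition G X Q X := by
  have hc : ∀ S : Set Unit, S.Nonempty → ((⊥ : SimpleGraph Unit).induce S).Connected := by
    rintro S ⟨a, ha⟩
    have : S = {a} := by ext b; simpa [Subsingleton.elim b a] using ha
    rw [this]
    exact connected_singleton a
  refine ⟨Unit, inferInstance, ⊥, fun _ => X, ⟨?_, fun _ => le_rfl, fun u hu v hv _ => ⟨(), hu, hv⟩,
    fun v hv => hc _ ⟨(), hv⟩⟩, fun _ => hX, (), rfl⟩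
  exact SimpleGraph.IsTree.of_subsingleton

theorem IsTreeDecomposition.glue [DecidableEq W] {S₁ S₂ : Finset W} {ι κ : Type} [Finite ι] [Finite κ]
    {t₁ : SimpleGraph ι} {t₂ : SimpleGraph κ} {bag₁ : ι → Finset W} {bag₂ : κ → Finset W}
    (h₁ : IsTreeDecomposition G S₁ t₁ bag₁) (h₂ : IsTreeDecomposition G S₂ t₂ bag₂) {a : ι} {b : κ}
    (ha : S₁ ∩ S₂ ⊆ bag₁ a) (hb : S₁ ∩ S₂ ⊆ bag₂ b)
    (hadj : ∀ u ∈ S₁, ∀ v ∈ S₂, G.Adj u v → u ∈ S₂ ∨ v ∈ S₁) :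
    IsTreeDecomposition G (S₁ ∪ S₂)
      (SimpleGraph.sum t₁ t₂ ⊔ SimpleGraph.edge (Sum.inl a) (Sum.inr b)) (Sum.elim bag₁ bag₂) := by
  refine ⟨IsTree.sum_sup_edge h₁.isTree h₂.isTree a b, ?_, ?_, ?_⟩
  · rintro (i | i)
    · exact (h₁.bag_subset i).trans Finset.subset_union_left
    · exact (h₂.bag_subset i).trans Finset.subset_union_right
  · intro u hu v hv huv
    have hl : u ∈ S₁ → v ∈ S₁ → ∃ i, u ∈ Sum.elim bag₁ bag₂ i ∧ v ∈ Sum.elim bag₁ bag₂ i :=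
      fun hu hv => let ⟨i, hi⟩ := h₁.exists_bag_of_adj u hu v hv huv; ⟨.inl i, hi⟩
    have hr : u ∈ S₂ → v ∈ S₂ → ∃ i, u ∈ Sum.elim bag₁ bag₂ i ∧ v ∈ Sum.elim bag₁ bag₂ i :=
      fun hu hv => let ⟨i, hi⟩ := h₂.exists_bag_of_adj u hu v hv huv; ⟨.inr i, hi⟩
    rw [Finset.mem_union] at hu hv
    have h3 := hadj u
    have h4 := fun hv hu => hadj v hv u hu huv.symm
    grind
  · intro v hv
    have hset : {i | v ∈ Sum.elim bag₁ bag₂ i} =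
        Sum.inl '' {i | v ∈ bag₁ i} ∪ Sum.inr '' {i | v ∈ bag₂ i} := by
      ext (i | i) <;> simp
    have hl : v ∈ S₁ → ((SimpleGraph.sum t₁ t₂ ⊔ SimpleGraph.edge (Sum.inl a) (Sum.inr b)).induce
        (Sum.inl '' {i | v ∈ bag₁ i})).Connected := fun hv =>
      connected_image_embedding (fun x y hxy => Or.inl (by simpa using hxy)) (h₁.connected v hv)
    have hr : v ∈ S₂ → ((SimpleGraph.sum t₁ t₂ ⊔ SimpleGraph.edge (Sum.inl a) (Sum.inr b)).induce
        (Sum.inr '' {i | v ∈ bag₂ i})).Connected := fun hv =>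
      connected_image_embedding (fun x y hxy => Or.inl (by simpa using hxy)) (h₂.connected v hv)
    rw [hset]
    by_cases hv1 : v ∈ S₁
    · by_cases hv2 : v ∈ S₂
      · have hvv := Finset.mem_inter.2 ⟨hv1, hv2⟩
        refine connected_union (hl hv1) (hr hv2) (Set.mem_image_of_mem _ (ha hvv))
          (Set.mem_image_of_mem _ (hb hvv)) (Or.inr (Or.inr ?_))
        simp [SimpleGraph.edge_adj]
      · have : {i | v ∈ bag₂ i} = ∅ := by
          ext i
          simpa using fun h => hv2 (h₂.bag_subset i h)
        rw [this, Set.image_empty, Set.union_empty]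
        exact hl hv1
    · have : {i | v ∈ bag₁ i} = ∅ := by
        ext i
        simpa using fun h => hv1 (h₁.bag_subset i h)
      rw [this, Set.image_empty, Set.empty_union]
      exact hr ((Finset.mem_union.1 hv).resolve_left hv1)

theorem HasDecomposition.glue [DecidableEq W] {S₁ S₂ X Y : Finset W} {Q : Finset W → Prop}
    (h₁ : HasDecomposition G S₁ Q X) (h₂ : HasDecomposition G S₂ Q Y)
    (hX : S₁ ∩ S₂ ⊆ X) (hY : S₁ ∩ S₂ ⊆ Y)
    (hadj : ∀ u ∈ S₁, ∀ v ∈ S₂, G.Adj u v → u ∈ S₂ ∨ v ∈ S₁) :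
    HasDecomposition G (S₁ ∪ S₂) Q X := by
  obtain ⟨ι, _, t₁, bag₁, h₁, hQ₁, a, rfl⟩ := h₁
  obtain ⟨κ, _, t₂, bag₂, h₂, hQ₂, b, rfl⟩ := h₂
  refine ⟨ι ⊕ κ, inferInstance, _, _, h₁.glue h₂ hX hY hadj, ?_, .inl a, rfl⟩
  rintro (i | i)
  exacts [hQ₁ i, hQ₂ i]

/-- In a tree decomposition, a connected set meeting the bags at `s` and `j` meets every bag
between them. -/
theorem IsTreeDecomposition.exists_mem_bag_of_connected {S : Finset W} {ι : Type}
    {t : SimpleGraph ι} {bag : ι → Finset W} (h : IsTreeDecomposition G S t bag) {A : Set ι}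
    {s j : ι} (hA : ∀ C : Set ι, (t.induce C).Connected → s ∈ C → j ∈ C → A ⊆ C) {P : Set W}
    (hP : (G.induce P).Connected) (hPS : P ⊆ S) (hs : ∃ x ∈ P, x ∈ bag s) (hj : ∃ x ∈ P, x ∈ bag j)
    {i : ι} (hi : i ∈ A) : ∃ x ∈ P, x ∈ bag i := by
  have hc : (t.induce (⋃ x ∈ P, {i | x ∈ bag i})).Connected :=
    connected_biUnion hP (fun x hx => h.connected x (hPS hx)) fun x hx y hy hxy => by
      obtain ⟨i, hi⟩ := h.exists_bag_of_adj x (hPS hx) y (hPS hy) hxy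
      exact ⟨i, hi.1, i, hi.2, Or.inl rfl⟩
  simpa using hA _ hc (by simpa using hs) (by simpa using hj) hi

/-- A bramble: a family of pairwise touching connected vertex sets. -/
def IsBramble (G : SimpleGraph W) (𝓑 : Finset (Finset W)) : Prop :=
  (∀ S ∈ 𝓑, (G.induce (S : Set W)).Connected) ∧
    ∀ S ∈ 𝓑, ∀ T ∈ 𝓑, ∃ a ∈ S, ∃ b ∈ T, a = b ∨ G.Adj a b

/-- `X` meets every member of `𝓑`. -/
def Covers (X : Finset W) (𝓑 : Finset (Finset W)) : Prop :=
  ∀ b ∈ 𝓑, ∃ x ∈ b, x ∈ X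

/-- A bag with more than `k` elements does not cover `𝓑`. -/
def IsGoodBag (k : ℕ) (𝓑 : Finset (Finset W)) (X : Finset W) : Prop :=
  k < X.card → ∃ b ∈ 𝓑, ∀ x ∈ b, x ∉ X

variable [DecidableEq W]

theorem hasDecomposition_of_not_isBramble_insert {k : ℕ} {𝓑 : Finset (Finset W)}
    (h𝓑 : IsBramble G 𝓑) {X C : Finset W} (hXk : X.card ≤ k)
    (hCc : (G.induce (C : Set W)).Connected) (hC𝓑 : ¬ IsBramble G (insert C 𝓑)) :
    HasDecomposition G (X ∪ C) (IsGoodBag k 𝓑) X := by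
  obtain ⟨b, hb, hbC⟩ : ∃ b ∈ 𝓑, ∀ x ∈ b, x ∉ C ∧ ∀ c ∈ C, ¬ G.Adj x c := by
    by_contra! hcon
    refine hC𝓑 ⟨?_, ?_⟩
    · intro S hS
      rcases Finset.mem_insert.1 hS with rfl | hS
      exacts [hCc, h𝓑.1 S hS]
    · intro S hS T hT
      have key : ∀ b ∈ 𝓑, ∃ x ∈ b, ∃ c ∈ C, x = c ∨ G.Adj x c := by
        intro b hb
        obtain ⟨x, hx, h⟩ := hcon b hb
        by_cases hxC : x ∈ C
        · exact ⟨x, hx, x, hxC, Or.inl rfl⟩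
        · obtain ⟨c, hc, hxc⟩ := h hxC
          exact ⟨x, hx, c, hc, Or.inr hxc⟩
      rcases Finset.mem_insert.1 hS with rfl | hS' <;> rcases Finset.mem_insert.1 hT with rfl | hT'
      · obtain ⟨⟨a, ha⟩⟩ := hCc.nonempty
        exact ⟨a, ha, a, ha, Or.inl rfl⟩
      · obtain ⟨x, hx, c, hc, h⟩ := key T hT'
        exact ⟨c, hc, x, hx, h.imp Eq.symm fun h => h.symm⟩
      · exact key S hS'
      · exact h𝓑.2 S hS' T hT'
  classical
  set N := X.filter fun x => ∃ c ∈ C, G.Adj x c with hN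
  have h₁ : HasDecomposition G X (IsGoodBag k 𝓑) X :=
    hasDecomposition_self fun h => absurd h (by omega)
  have h₂ : HasDecomposition G (X ∩ C ∪ (C ∪ N)) (IsGoodBag k 𝓑) (X ∩ C ∪ (C ∪ N)) :=
    hasDecomposition_self fun _ => ⟨b, hb, fun x hx hxn => by
      have := hbC x hx
      simp only [hN, Finset.mem_union, Finset.mem_inter, Finset.mem_filter] at hxn
      rcases hxn with h | h | ⟨-, c, hc, h⟩
      exacts [this.1 h.2, this.1 h, this.2 c hc h]⟩
  have := h₁.glue h₂ Finset.inter_subset_left Finset.inter_subset_right fun u hu v hv huv => by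
    simp only [hN, Finset.mem_union, Finset.mem_inter, Finset.mem_filter] at hv ⊢
    rcases hv with h | h | h
    · exact Or.inr h.1
    · exact Or.inl (Or.inr (Or.inr ⟨hu, v, h, huv⟩))
    · exact Or.inr h.1
  convert this using 1
  ext v
  simp only [hN, Finset.mem_union, Finset.mem_inter, Finset.mem_filter]
  tauto

variable [Fintype W]

/-- Disjoint connected sets, rooted in a minimum cover `X` of a bramble and leading to another cover
`Y` while avoiding a component `C` of the complement of `X`. -/
theorem exists_linkage_of_minimum_cover {𝓑 : Finset (Finset W)} (h𝓑 : IsBramble G 𝓑) {X Y C : Finset W}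
    (hX : Covers X 𝓑) (hmin : ∀ Z, Covers Z 𝓑 → X.card ≤ Z.card) (hY : Covers Y 𝓑)
    (hYC : Disjoint Y C) (hC : ∀ a ∈ C, ∀ b, G.Adj a b → b ∈ C ∨ b ∈ X) :
    ∃ P : W → Set W, (∀ x ∈ X, (G.induce (P x)).Connected ∧ (∃ a ∈ P x, a ∈ Y) ∧ x ∈ P x ∧
        ∀ y ∈ P x, y ∈ X ∪ C → y = x) ∧ ∀ x ∈ X, ∀ y ∈ X, x ≠ y → Disjoint (P x) (P y) := by
  have hlink : Linked G X Y X.card := by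
    refine linked_of_forall_separatesVia _ _ _ _ fun K R ⟨h1, h2, h3, h4⟩ => hmin K fun b hb => ?_
    by_contra! hbK
    obtain ⟨x, hxb, hxX⟩ := hX b hb
    obtain ⟨y, hyb, hyY⟩ := hY b hb
    have hbR : (b : Set W) ⊆ R := subset_of_connected_of_closed (h𝓑.1 b hb) hxb
      ((h1 hxX).resolve_right (hbK x hxb)) fun u hu _ v hv huv =>
        (h4 u hu v huv).resolve_right (hbK v hv)
    exact Set.disjoint_left.1 h3 (hbR hyb) hyY
  obtain ⟨P, hP, hdis⟩ := hlink.symm.exists_indexed rfl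
  have key : ∀ x ∈ X, ∃ D : Set W, D ⊆ P x ∧ (G.induce D).Connected ∧ (∃ a ∈ D, a ∈ Y) ∧ x ∈ D ∧
      ∀ y ∈ D, y ∈ X ∪ C → y = x := by
    intro x hx
    obtain ⟨hc, ⟨a, haP, haY⟩, hxP, huniq⟩ := hP x hx
    by_cases hax : a = x
    · subst hax
      exact ⟨{a}, by simpa using hxP, connected_singleton a, ⟨a, rfl, haY⟩, rfl, fun y hy _ => hy⟩
    · obtain ⟨D, hDP, haD, hDc, c, hcD, hcx⟩ := exists_connected_avoiding hc haP hxP hax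
      have hDX : ∀ y ∈ D, y ∉ X := fun y hy hyX => (hDP hy).2 (huniq y hyX (hDP hy).1)
      have hDC : ∀ y ∈ D, y ∉ C := fun y hy hyC => by
        have : D ⊆ (C : Set W) := subset_of_connected_of_closed hDc hy hyC fun u hu _ v hv huv =>
          (hC u hu v huv).resolve_right (hDX v hv)
        exact Finset.disjoint_left.1 hYC haY (this haD)
      refine ⟨insert x D, Set.insert_subset hxP fun y hy => (hDP hy).1, connected_insert hDc hcD hcx,
        ⟨a, Or.inr haD, haY⟩, Or.inl rfl, ?_⟩
      rintro y (rfl | hy) hyXC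
      · rfl
      · exact absurd (Finset.mem_union.1 hyXC) (not_or.2 ⟨hDX y hy, hDC y hy⟩)
  choose! D hDP hD using key
  exact ⟨D, hD, fun x hx y hy hxy => (hdis x hx y hy hxy).mono (hDP x hx) (hDP y hy)⟩

theorem hasDecomposition_of_isGoodBag_insert {k : ℕ} {𝓑 : Finset (Finset W)} (h𝓑 : IsBramble G 𝓑)
    {X C : Finset W} (hX : Covers X 𝓑) (hmin : ∀ Z, Covers Z 𝓑 → X.card ≤ Z.card)
    (hXk : X.card ≤ k) (hC : ∀ a ∈ C, ∀ b, G.Adj a b → b ∈ C ∨ b ∈ X)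
    {ι : Type} [Fintype ι] {t : SimpleGraph ι} {bag : ι → Finset W}
    (h : IsTreeDecomposition G Finset.univ t bag) (hgood : ∀ i, IsGoodBag k (insert C 𝓑) (bag i))
    {s : ι} (hs : ¬ IsGoodBag k 𝓑 (bag s)) : HasDecomposition G (X ∪ C) (IsGoodBag k 𝓑) X := by
  obtain ⟨hsk, hscov⟩ : k < (bag s).card ∧ Covers (bag s) 𝓑 := by
    simpa [IsGoodBag, Covers] using hs
  have hsC : Disjoint (bag s) C := by
    obtain ⟨b, hb, hbs⟩ := hgood s hsk
    rcases Finset.mem_insert.1 hb with rfl | hb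
    · exact (Finset.disjoint_left.2 hbs).symm
    · obtain ⟨x, hx, hxs⟩ := hscov b hb
      exact absurd hxs (hbs x hx)
  obtain ⟨P, hP, hPdis⟩ := exists_linkage_of_minimum_cover h𝓑 hX hmin hscov hsC hC
  choose τ hτ using fun x : W => h.exists_mem_bag (Finset.mem_univ x)
  choose A hsA hτA hAc hAmin using fun x : W => exists_minimal_connected_of_isTree h.isTree s (τ x)
  classical
  set bag' : ι → Finset W := fun i => (bag i ∩ (X ∪ C)) ∪ X.filter (fun x => i ∈ A x) with hbag'
  have hmem : ∀ i v, v ∈ bag' i ↔ (v ∈ bag i ∧ (v ∈ X ∨ v ∈ C)) ∨ (v ∈ X ∧ i ∈ A v) := by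
    intro i v
    simp [hbag']
  have hcard : ∀ i, (bag' i).card ≤ (bag i).card := by
    intro i
    have hz : ∀ x : W, ∃ z, (x ∈ X ∧ i ∈ A x) → z ∈ P x ∧ z ∈ bag i := by
      intro x
      by_cases hx : x ∈ X ∧ i ∈ A x
      · obtain ⟨z, hz⟩ := h.exists_mem_bag_of_connected (hAmin x) (hP x hx.1).1 (fun _ _ => by simp)
          (hP x hx.1).2.1 ⟨x, (hP x hx.1).2.2.1, hτ x⟩ hx.2
        exact ⟨z, fun _ => hz⟩
      · exact ⟨x, fun h => absurd h hx⟩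
    choose z hz using hz
    refine Finset.card_le_card_of_injOn (fun x => if x ∈ bag i then x else z x) ?_ ?_
    · intro x hx
      have hx := (hmem i x).1 hx
      by_cases hxi : x ∈ bag i
      · simp [hxi]
      · simpa [hxi] using (hz x (by tauto)).2
    · intro x hx y hy hxy
      have hx := (hmem i x).1 hx
      have hy := (hmem i y).1 hy
      have key : ∀ x y, x ∈ bag i → (x ∈ X ∨ x ∈ C) → y ∉ bag i → (y ∈ X ∧ i ∈ A y) → x = z y →
          False := by
        intro x y hxi hxX hyi hyA hxy
        have h1 := (hP y hyA.1).2.2.2 (z y) (hz y hyA).1 (by rw [← hxy]; simpa using hxX)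
        rw [← hxy] at h1
        exact hyi (h1 ▸ hxi)
      by_cases hxi : x ∈ bag i <;> by_cases hyi : y ∈ bag i <;> simp only [hxi, hyi, if_true, if_false] at hxy
      · exact hxy
      · exact (key x y hxi (by tauto) hyi (by tauto) hxy).elim
      · exact (key y x hyi (by tauto) hxi (by tauto) hxy.symm).elim
      · by_contra hne
        have hx : x ∈ X ∧ i ∈ A x := by tauto
        have hy : y ∈ X ∧ i ∈ A y := by tauto
        exact Set.disjoint_left.1 (hPdis x hx.1 y hy.1 hne) (hz x hx).1 (hxy ▸ (hz y hy).1)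
  refine ⟨ι, inferInstance, t, bag', ⟨h.isTree, ?_, ?_, ?_⟩, ?_, s, ?_⟩
  · intro i v hv
    have := (hmem i v).1 hv
    simp only [Finset.mem_union]
    tauto
  · intro u hu v hv huv
    obtain ⟨i, hi⟩ := h.exists_bag_of_adj u (by simp) v (by simp) huv
    rw [Finset.mem_union] at hu hv
    exact ⟨i, (hmem i u).2 (Or.inl ⟨hi.1, hu⟩), (hmem i v).2 (Or.inl ⟨hi.2, hv⟩)⟩
  · intro v hv
    have hv' := Finset.mem_union.1 hv
    have hvc := h.connected v (by simp)
    by_cases hvX : v ∈ X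
    · have : {i | v ∈ bag' i} = {i | v ∈ bag i} ∪ A v := by
        ext i
        simp [hmem, hvX]
      rw [this]
      exact connected_union hvc (hAc v) (hτ v) (hτA v) (Or.inl rfl)
    · have : {i | v ∈ bag' i} = {i | v ∈ bag i} := by
        ext i
        simp [hmem, hvX, hv'.resolve_left hvX]
      rwa [this]
  · intro i hik
    obtain ⟨b, hb, hbi⟩ := hgood i (hik.trans_le (hcard i))
    obtain ⟨c, hci, hcX⟩ : ∃ c ∈ bag' i, c ∉ X := by
      by_contra! hsub
      exact absurd (Finset.card_le_card hsub) (by omega)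
    have hc : c ∈ bag i ∧ c ∈ C := by have := (hmem i c).1 hci; tauto
    rcases Finset.mem_insert.1 hb with rfl | hb
    · exact absurd hc.1 (hbi c hc.2)
    · refine ⟨b, hb, fun y hyb hyi => ?_⟩
      have hy : y ∈ X ∧ i ∈ A y := by
        have h1 := (hmem i y).1 hyi
        have h2 := hbi y hyb
        tauto
      obtain ⟨z, hzb, hzi⟩ := h.exists_mem_bag_of_connected (hAmin y) (h𝓑.1 b hb)
        (fun _ _ => by simp) (hscov b hb) ⟨y, hyb, hτ y⟩ hy.2
      exact hbi z hzb hzi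
  · ext v
    rw [hmem]
    constructor
    · rintro (⟨h1, h2⟩ | h1)
      · exact h2.resolve_right (Finset.disjoint_left.1 hsC h1)
      · exact h1.1
    · exact fun hv => Or.inr ⟨hv, hsA v⟩

/-- Decompositions of all `G.induce (X ∪ C)`, with `C` a component of `G - X`, can be glued
along `X`. -/
theorem hasDecomposition_univ_of_forall_component {Q : Finset W → Prop} {X : Finset W} (hX : Q X)
    (h : ∀ C : Finset W, (G.induce (C : Set W)).Connected → Disjoint X C →
      (∀ a ∈ C, ∀ b, G.Adj a b → b ∈ C ∨ b ∈ X) → HasDecomposition G (X ∪ C) Q X) :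
    HasDecomposition G Finset.univ Q X := by
  classical
  let p : Finset W → Prop := fun S => X ⊆ S ∧ (∀ a ∈ S, a ∉ X → ∀ b, G.Adj a b → b ∈ S) ∧
    HasDecomposition G S Q X
  obtain ⟨S, hS⟩ := (Set.toFinite {S | p S}).exists_maximal
    ⟨X, le_rfl, fun a ha ha' => absurd ha ha', hasDecomposition_self hX⟩
  obtain ⟨hXS, hcl, hdec⟩ := hS.prop
  by_cases hSu : S = Finset.univ
  · rwa [← hSu]
  exfalso
  obtain ⟨w, hw⟩ : ∃ w, w ∉ S := by
    by_contra! hall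
    exact hSu (Finset.eq_univ_iff_forall.2 hall)
  obtain ⟨C, hCS, hwC, hCc, hCcl⟩ := exists_component (G := G) (S := (Sᶜ : Set W)) (a := w) hw
  have hCS' : ∀ x ∈ C, x ∉ S := fun x hx => hCS hx
  have hCout : ∀ a ∈ C, ∀ b, G.Adj a b → b ∈ C ∨ b ∈ X := by
    intro a ha b hab
    by_cases hbS : b ∈ S
    · by_cases hbX : b ∈ X
      · exact Or.inr hbX
      · exact absurd (hcl b hbS hbX a hab.symm) (hCS' a ha)
    · exact Or.inl (hCcl a ha b hbS hab)
  have hC := h C.toFinset (by rwa [Set.coe_toFinset])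
    (Finset.disjoint_left.2 fun x hx hxC => hCS' x (by simpa using hxC) (hXS hx))
    (by simpa using hCout)
  have hint : S ∩ (X ∪ C.toFinset) ⊆ X := by
    intro x hx
    simp only [Finset.mem_inter, Finset.mem_union, Set.mem_toFinset] at hx
    exact hx.2.resolve_right fun hxC => hCS' x hxC hx.1
  have hglue := hdec.glue hC hint hint fun u hu v hv huv => by
    simp only [Finset.mem_union, Set.mem_toFinset] at hv ⊢
    rcases hv with hv | hv
    · exact Or.inr (hXS hv)
    · exact Or.inl ((hCout v hv u huv.symm).symm)
  have hle := hS.le_of_ge (y := S ∪ (X ∪ C.toFinset)) ⟨hXS.trans Finset.subset_union_left, ?_, hglue⟩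
    Finset.subset_union_left
  · exact hw (hle (by simp [hwC]))
  · intro a ha haX b hab
    simp only [Finset.mem_union, Set.mem_toFinset] at ha ⊢
    rcases ha with ha | ha | ha
    · exact Or.inl (hcl a ha haX b hab)
    · exact absurd ha haX
    · exact Or.inr (hCout a ha b hab).symm

/-- The hard direction of the treewidth duality theorem, in a form suited for induction. -/
theorem exists_hasDecomposition_of_forall_bramble {k : ℕ}
    (hk : ∀ 𝓑, IsBramble G 𝓑 → ∃ X : Finset W, X.card ≤ k ∧ Covers X 𝓑)
    (𝓑 : Finset (Finset W)) (h𝓑 : IsBramble G 𝓑) :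
    ∃ X, HasDecomposition G Finset.univ (IsGoodBag k 𝓑) X := by
  obtain ⟨X, hX⟩ := (Set.toFinite {X | Covers X 𝓑}).exists_minimalFor Finset.card _
    (let ⟨X, hX⟩ := hk 𝓑 h𝓑; ⟨X, hX.2⟩)
  have hmin : ∀ Z, Covers Z 𝓑 → X.card ≤ Z.card := fun Z hZ =>
    (le_total X.card Z.card).elim id (hX.2 hZ)
  have hXk : X.card ≤ k := let ⟨Z, hZ⟩ := hk 𝓑 h𝓑; (hmin Z hZ.2).trans hZ.1
  by_contra! hno
  refine hno X (hasDecomposition_univ_of_forall_component (fun h => absurd h (by omega)) ?_)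
  intro C hCc hXC hC
  by_cases hC𝓑 : IsBramble G (insert C 𝓑)
  · have hCnot : C ∉ 𝓑 := fun hmem =>
      let ⟨x, hx, hxX⟩ := hX.1 C hmem
      Finset.disjoint_left.1 hXC hxX hx
    obtain ⟨Y, ι, _, t, bag, hdec, hgood, s, rfl⟩ :=
      exists_hasDecomposition_of_forall_bramble hk (insert C 𝓑) hC𝓑
    obtain ⟨s', hs'⟩ : ∃ s, ¬ IsGoodBag k 𝓑 (bag s) := by
      by_contra! hall
      exact hno _ ⟨ι, inferInstance, t, bag, hdec, hall, s, rfl⟩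
    exact hasDecomposition_of_isGoodBag_insert h𝓑 hX.1 hmin hXk hC hdec hgood hs'
  · exact hasDecomposition_of_not_isBramble_insert h𝓑 hXk hCc hC𝓑
termination_by Fintype.card (Finset W) - 𝓑.card
decreasing_by
  have h1 := Finset.card_le_univ (insert C 𝓑)
  rw [Finset.card_insert_of_notMem hCnot] at h1 ⊢
  omega

theorem exists_isBramble_of_lt_treewidth {k : ℕ} (hk : 1 ≤ k) (h : k ≤ treewidth G) :
    ∃ 𝓑, IsBramble G 𝓑 ∧ ∀ X : Finset W, X.card ≤ k → ∃ b ∈ 𝓑, ∀ x ∈ b, x ∉ X := by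
  by_contra! hcon
  obtain ⟨X, ι, _, t, bag, hdec, hgood, -⟩ := exists_hasDecomposition_of_forall_bramble (G := G) (k := k)
    (fun 𝓑 h𝓑 => by
      obtain ⟨X, hX, hcov⟩ := hcon 𝓑 h𝓑
      exact ⟨X, hX, hcov⟩) ∅ (by simp [IsBramble])
  have hle : treewidth G ≤ k - 1 := by
    refine Nat.sInf_le ⟨ι, inferInstance, t, bag, hdec.isTree, fun v => hdec.exists_mem_bag (by simp),
      fun u v => hdec.exists_bag_of_adj u (by simp) v (by simp), fun v => hdec.connected v (by simp),
      fun i => ?_⟩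
    by_contra! hlt
    obtain ⟨b, hb, -⟩ := hgood i (by omega)
    simp at hb
  omega

end TreeDecomposition

section Boundary

variable {W : Type*} {G : SimpleGraph W}

/-- The subgraph of `G` with all edges inside `S` satisfying `r`. -/
def restrictEdges (G : SimpleGraph W) (S : Set W) (r : W → W → Prop) : SimpleGraph W :=
  SimpleGraph.mk (fun x y => G.Adj x y ∧ x ∈ S ∧ y ∈ S ∧ r x y ∧ r y x)
    ⟨fun _ _ h => ⟨h.1.symm, h.2.2.1, h.2.1, h.2.2.2.2, h.2.2.2.1⟩⟩ ⟨fun _ h => h.1.ne rfl⟩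

theorem restrictEdges_le (S : Set W) (r : W → W → Prop) : restrictEdges G S r ≤ G :=
  fun _ _ h => h.1

theorem subset_of_connected_restrictEdges {S : Set W} {r : W → W → Prop} {P : Set W}
    (hP : ((restrictEdges G S r).induce P).Connected) {a : W} (ha : a ∈ P) (haS : a ∈ S) : P ⊆ S :=
  subset_of_connected_of_closed hP ha haS fun _ _ _ _ _ h => h.2.2.1

variable [Fintype W]

open Classical in
/-- The vertices outside `U` with a neighbour in `U`. -/
noncomputable def outerBoundary (G : SimpleGraph W) (U : Finset W) : Finset W :=
  Finset.univ.filter fun w => w ∉ U ∧ ∃ u ∈ U, G.Adj u w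

theorem mem_outerBoundary {U : Finset W} {w : W} :
    w ∈ outerBoundary G U ↔ w ∉ U ∧ ∃ u ∈ U, G.Adj u w := by
  simp [outerBoundary]

/-- `U` is minimal among the sets containing a member of `𝓑` with outer boundary of size at most
`i`, and its outer boundary has size exactly `i`. -/
structure IsTight (G : SimpleGraph W) (𝓑 : Finset (Finset W)) (U : Finset W) (i : ℕ) : Prop where
  exists_subset : ∃ b ∈ 𝓑, b ⊆ U
  card_eq : (outerBoundary G U).card = i
  eq_of_subset : ∀ U' ⊆ U, (∃ b ∈ 𝓑, b ⊆ U') → (outerBoundary G U').card ≤ i → U' = U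

theorem exists_minimal_card_outerBoundary_le {𝓑 : Finset (Finset W)} {U : Finset W} {i : ℕ}
    (hU : ∃ b ∈ 𝓑, b ⊆ U) (hi : (outerBoundary G U).card ≤ i) :
    ∃ U₁ ⊆ U, (∃ b ∈ 𝓑, b ⊆ U₁) ∧ (outerBoundary G U₁).card ≤ i ∧
      ∀ U' ⊆ U₁, (∃ b ∈ 𝓑, b ⊆ U') → (outerBoundary G U').card ≤ i → U' = U₁ := by
  obtain ⟨U₁, hle, hU₁⟩ := (Set.toFinite {U' : Finset W | (∃ b ∈ 𝓑, b ⊆ U') ∧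
    (outerBoundary G U').card ≤ i}).exists_le_minimal (a := U) ⟨hU, hi⟩
  exact ⟨U₁, hle, hU₁.prop.1, hU₁.prop.2, fun U' hsub hb hc =>
    le_antisymm hsub (hU₁.le_of_le ⟨hb, hc⟩ hsub)⟩

/-- A bramble of large order always has a member deep inside a set with small boundary. -/
theorem exists_mem_subset_of_outerBoundary_subset {𝓑 : Finset (Finset W)} (h𝓑 : IsBramble G 𝓑)
    {U X : Finset W} (hU : ∃ b ∈ 𝓑, b ⊆ U) (hX : ∃ b ∈ 𝓑, ∀ x ∈ b, x ∉ X)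
    (hUX : outerBoundary G U ⊆ X) : ∃ b ∈ 𝓑, b ⊆ U ∧ ∀ x ∈ b, x ∉ X := by
  obtain ⟨b₀, hb₀, hb₀U⟩ := hU
  obtain ⟨b, hb, hbX⟩ := hX
  obtain ⟨x, hx, y, hy, hxy⟩ := h𝓑.2 b hb b₀ hb₀
  have hout : ∀ x ∈ b, ∀ u ∈ U, G.Adj u x → x ∈ U := fun x hx u hu hux => by
    by_contra hxU
    exact hbX x hx (hUX (mem_outerBoundary.2 ⟨hxU, u, hu, hux⟩))
  have hxU : x ∈ U := by
    rcases hxy with rfl | hxy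
    · exact hb₀U hy
    · exact hout x hx y (hb₀U hy) hxy.symm
  exact ⟨b, hb, subset_of_connected_of_closed (R := (U : Set W)) (h𝓑.1 b hb) hx hxU
    fun u hu _ v hv huv => hout v hv u hu huv, hbX⟩

theorem IsTight.connected {𝓑 : Finset (Finset W)} (h𝓑 : IsBramble G 𝓑) {U : Finset W} {i : ℕ}
    (h : IsTight G 𝓑 U i) : (G.induce (U : Set W)).Connected := by
  classical
  obtain ⟨b, hb, hbU⟩ := h.exists_subset
  obtain ⟨⟨a, ha⟩⟩ := (h𝓑.1 b hb).nonempty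
  obtain ⟨C, hCU, haC, hCc, hC⟩ := exists_component (G := G) (S := (U : Set W)) (a := a) (hbU ha)
  have hbC : (b : Set W) ⊆ C := subset_of_connected_of_closed (h𝓑.1 b hb) ha haC
    fun x hx _ y hy hxy => hC x hx y (hbU hy) hxy
  have : C.toFinset = U := by
    refine h.eq_of_subset _ (fun x hx => hCU (by simpa using hx)) ⟨b, hb, fun x hx => ?_⟩
      ((Finset.card_le_card fun w hw => ?_).trans h.card_eq.le)
    · simpa using hbC hx
    · simp only [mem_outerBoundary, Set.mem_toFinset] at hw ⊢
      obtain ⟨hwC, u, hu, huw⟩ := hw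
      exact ⟨fun hwU => hwC (hC u hu w hwU huw), u, hCU hu, huw⟩
  rw [← this, Set.coe_toFinset]
  exact hCc

/-- The linkage from the boundary of a tight set (with one more vertex) to the boundary of the next
tight set. -/
theorem IsTight.linked {𝓑 : Finset (Finset W)} {U U' : Finset W} {i : ℕ} {v : W}
    (h : IsTight G 𝓑 U i) (hv : v ∈ U) (h' : ∃ b ∈ 𝓑, b ⊆ U') (hU' : U' ⊆ U) (hvU' : v ∉ U')
    [DecidableEq W] :
    Linked (restrictEdges G {x | (x ∈ U ∨ x ∈ outerBoundary G U) ∧ x ∉ U'} fun _ _ => True)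
      (insert v (outerBoundary G U)) (outerBoundary G U') (i + 1) := by
  refine linked_of_forall_separatesVia _ _ _ _ fun K R ⟨h1, h2, h3, h4⟩ => ?_
  by_contra! hK
  classical
  set U₂ : Finset W := (U ∪ outerBoundary G U).filter fun x => x ∈ U' ∨ (x ∉ R ∧ x ∉ K) with hU₂
  have hmem : ∀ x, x ∈ U₂ ↔ (x ∈ U ∨ x ∈ outerBoundary G U) ∧ (x ∈ U' ∨ (x ∉ R ∧ x ∉ K)) := by
    simp [hU₂]
  have hY : ∀ y, y = v ∨ y ∈ outerBoundary G U → y ∉ U₂ := by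
    intro y hy hyU₂
    have hyU' : y ∉ U' := by
      rcases hy with rfl | hy
      · exact hvU'
      · exact fun hyU' => (mem_outerBoundary.1 hy).1 (hU' hyU')
    have := ((hmem y).1 hyU₂).2.resolve_left hyU'
    rcases h1 (by simpa using hy) with h | h
    · exact this.1 h
    · exact this.2 h
  have hsub : U₂ ⊆ U := fun x hx =>
    ((hmem x).1 hx).1.resolve_right fun hxb => hY x (Or.inr hxb) hx
  have hbd : outerBoundary G U₂ ⊆ K := by
    intro w hw
    obtain ⟨hwU₂, u, hu, huw⟩ := mem_outerBoundary.1 hw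
    have hwS : w ∈ U ∨ w ∈ outerBoundary G U := by
      by_cases hwU : w ∈ U
      · exact Or.inl hwU
      · exact Or.inr (mem_outerBoundary.2 ⟨hwU, u, hsub hu, huw⟩)
    rw [hmem] at hwU₂
    by_contra hwK
    have hwU' : w ∉ U' := by tauto
    have hwR : w ∈ R := by
      have : ¬ (w ∉ R ∧ w ∉ K) := by tauto
      tauto
    by_cases huU' : u ∈ U'
    · exact Set.disjoint_left.1 h3 hwR (mem_outerBoundary.2 ⟨hwU', u, huU', huw⟩)
    · have hu' := ((hmem u).1 hu).2.resolve_left huU'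
      rcases h4 w hwR u ⟨huw.symm, ⟨hwS, hwU'⟩, ⟨Or.inl (hsub hu), huU'⟩, trivial, trivial⟩ with h | h
      · exact hu'.1 h
      · exact hu'.2 h
  have heq := h.eq_of_subset U₂ hsub (let ⟨b, hb, hbU'⟩ := h'
    ⟨b, hb, fun x hx => (hmem x).2 ⟨Or.inl (hU' (hbU' hx)), Or.inl (hbU' hx)⟩⟩)
    ((Finset.card_le_card hbd).trans (by omega))
  exact hY v (Or.inl rfl) (heq ▸ hv)

/-- The boundary of a tight set can be halved arbitrarily and linked through the set. -/
theorem IsTight.linked_halves {𝓑 : Finset (Finset W)} (h𝓑 : IsBramble G 𝓑) {n : ℕ}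
    (hord : ∀ X : Finset W, X.card ≤ 3 * n - 1 → ∃ b ∈ 𝓑, ∀ x ∈ b, x ∉ X) {U Y Z : Finset W}
    (h : IsTight G 𝓑 U (2 * n)) [DecidableEq W] (hYZ : outerBoundary G U = Y ∪ Z)
    (hY : Y.card = n) (hZ : Z.card = n) :
    Linked (restrictEdges G (U ∪ outerBoundary G U) fun x y => x ∈ U ∨ y ∈ U) Y Z n := by
  set G' := restrictEdges G (U ∪ outerBoundary G U) fun x y => x ∈ U ∨ y ∈ U with hG'
  have key : ∀ (K : Finset W) (R : Set W) (A B : Finset W), K.card < n → B.card = n →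
      outerBoundary G U = A ∪ B → (∃ b ∈ 𝓑, b ⊆ U ∧ ∀ x ∈ b, x ∉ R ∧ x ∉ K) →
      SeparatesVia G' A B K R → False := by
    rintro K R A B hK hB hAB ⟨b, hb, hbU, hbR⟩ ⟨h1, h2, h3, h4⟩
    classical
    set U₂ := U.filter fun x => x ∉ R ∧ x ∉ K with hU₂
    have hbd : outerBoundary G U₂ ⊆ K ∪ B := by
      intro w hw
      obtain ⟨hwU₂, u, hu, huw⟩ := mem_outerBoundary.1 hw
      obtain ⟨huU, huR, huK⟩ : u ∈ U ∧ u ∉ R ∧ u ∉ K := by simpa [hU₂] using hu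
      have hwS : w ∈ U ∨ w ∈ outerBoundary G U := by
        by_cases hwU : w ∈ U
        · exact Or.inl hwU
        · exact Or.inr (mem_outerBoundary.2 ⟨hwU, u, huU, huw⟩)
      have hwR : w ∉ R := fun hwR => by
        rcases h4 w hwR u ⟨huw.symm, hwS, Or.inl huU, Or.inr huU, Or.inl huU⟩ with h | h
        exacts [huR h, huK h]
      rw [Finset.mem_union]
      by_contra! hwn
      have hwU : w ∉ U := fun hwU => hwU₂ (by simp [hU₂, hwU, hwR, hwn.1])
      have hwA : w ∈ A := by
        have := hwS.resolve_left hwU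
        rw [hAB, Finset.mem_union] at this
        exact this.resolve_right hwn.2
      rcases h1 hwA with h | h
      exacts [hwR h, hwn.1 h]
    have hc : (outerBoundary G U₂).card < 2 * n := by
      have := (Finset.card_le_card hbd).trans (Finset.card_union_le _ _)
      omega
    have heq := h.eq_of_subset U₂ (Finset.filter_subset _ _)
      ⟨b, hb, fun x hx => by simpa [hU₂, hbU hx] using hbR x hx⟩ hc.le
    rw [heq, h.card_eq] at hc
    exact lt_irrefl _ hc
  refine linked_of_forall_separatesVia _ _ _ _ fun K R hsep => ?_
  by_contra! hK
  obtain ⟨b, hb, hbU, hbX⟩ := exists_mem_subset_of_outerBoundary_subset h𝓑 h.exists_subset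
    (X := outerBoundary G U ∪ K) (hord _ (by
      have := Finset.card_union_le (outerBoundary G U) K
      have := h.card_eq
      omega)) Finset.subset_union_left
  have hbK : ∀ x ∈ b, x ∉ K := fun x hx hxK => hbX x hx (Finset.mem_union_right _ hxK)
  by_cases hbR : ∃ a ∈ b, a ∈ R
  · obtain ⟨a, hab, haR⟩ := hbR
    have hbR : (b : Set W) ⊆ R := subset_of_connected_of_closed (h𝓑.1 b hb) hab haR
      fun x hx hxb y hy hxy => (hsep.2.2.2 x hx y ⟨hxy, Or.inl (hbU hxb), Or.inl (hbU hy),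
        Or.inl (hbU hxb), Or.inl (hbU hy)⟩).resolve_right (hbK y hy)
    refine key K _ Z Y hK hY (by rw [hYZ, Finset.union_comm])
      ⟨b, hb, hbU, fun x hx => ⟨?_, hbK x hx⟩⟩ hsep.symm
    exact fun hx' => hx' (Or.inl (hbR hx))
  · push Not at hbR
    exact key K R Y Z hK hZ hYZ ⟨b, hb, hbU, fun x hx => ⟨hbR x hx, hbK x hx⟩⟩ hsep

/-- Disjoint connected sets `M j`, for `j < i`, outside `U`, rooted at the vertices of the outer
boundary of `U` and such that `M j` is adjacent to `M k` whenever `par j = some k`. -/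
structure IsRootedModel (G : SimpleGraph W) (par : ℕ → Option ℕ) (U : Finset W) (i : ℕ)
    (M : ℕ → Set W) (root : ℕ → W) : Prop where
  connected : ∀ j < i, (G.induce (M j)).Connected
  root_mem : ∀ j < i, root j ∈ M j
  disjoint : ∀ j < i, ∀ k < i, j ≠ k → Disjoint (M j) (M k)
  notMem : ∀ j < i, ∀ x ∈ M j, x ∉ U
  mem_outerBoundary_iff : ∀ w, w ∈ outerBoundary G U ↔ ∃ j < i, root j = w
  exists_adj : ∀ j < i, ∀ k, par j = some k → ∃ a ∈ M j, ∃ b ∈ M k, G.Adj a b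

theorem IsRootedModel.succ {𝓑 : Finset (Finset W)} (h𝓑 : IsBramble G 𝓑) {par : ℕ → Option ℕ}
    (hpar : ∀ j k, par j = some k → k < j) {U : Finset W} {i : ℕ} {M : ℕ → Set W} {root : ℕ → W}
    (hM : IsRootedModel G par U i M root) (hU : IsTight G 𝓑 U i)
    (hord : ∀ X : Finset W, X.card ≤ i + 1 → ∃ b ∈ 𝓑, ∀ x ∈ b, x ∉ X) :
    ∃ U' M' root', IsTight G 𝓑 U' (i + 1) ∧ IsRootedModel G par U' (i + 1) M' root' := by
  classical
  obtain ⟨v, hvU, hv⟩ : ∃ v ∈ U, ∀ k, par i = some k → G.Adj v (root k) := by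
    rcases hp : par i with _ | k
    · obtain ⟨b, hb, hbU⟩ := hU.exists_subset
      obtain ⟨⟨a, ha⟩⟩ := (h𝓑.1 b hb).nonempty
      exact ⟨a, hbU ha, by simp⟩
    · obtain ⟨-, u, hu, huk⟩ := mem_outerBoundary.1
        ((hM.mem_outerBoundary_iff _).2 ⟨k, hpar i k hp, rfl⟩)
      exact ⟨u, hu, by simpa using huk⟩
  have hvX : v ∉ outerBoundary G U := fun h => (mem_outerBoundary.1 h).1 hvU
  have hYcard : (insert v (outerBoundary G U)).card = i + 1 := by
    rw [Finset.card_insert_of_notMem hvX, hU.card_eq]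
  obtain ⟨b, hb, hbU, hbX⟩ := exists_mem_subset_of_outerBoundary_subset h𝓑 hU.exists_subset
    (hord _ hYcard.le) (Finset.subset_insert v _)
  have hbd : outerBoundary G (U.erase v) ⊆ insert v (outerBoundary G U) := by
    intro w hw
    obtain ⟨hwU, u, hu, huw⟩ := mem_outerBoundary.1 hw
    rw [Finset.mem_insert, or_iff_not_imp_left]
    exact fun hwv => mem_outerBoundary.2
      ⟨fun h => hwU (Finset.mem_erase.2 ⟨hwv, h⟩), u, Finset.mem_of_mem_erase hu, huw⟩
  obtain ⟨U', hU'v, hbU', hU'c, hU'min⟩ := exists_minimal_card_outerBoundary_le (G := G) (𝓑 := 𝓑)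
    (U := U.erase v) (i := i + 1)
    ⟨b, hb, fun x hx => Finset.mem_erase.2 ⟨fun h => hbX x hx (by simp [h]), hbU hx⟩⟩
    ((Finset.card_le_card hbd).trans hYcard.le)
  have hU'U : U' ⊆ U := hU'v.trans (Finset.erase_subset _ _)
  have hvU' : v ∉ U' := fun h => Finset.notMem_erase v U (hU'v h)
  have hU'card : (outerBoundary G U').card = i + 1 := by
    refine le_antisymm hU'c (Nat.succ_le_of_lt ?_)
    by_contra! hle
    exact hvU' (hU.eq_of_subset U' hU'U hbU' hle ▸ hvU)
  obtain ⟨P, hP, hPdis⟩ := (hU.linked hvU hbU' hU'U hvU').symm.exists_indexed hYcard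
  set S : Set W := {x | (x ∈ U ∨ x ∈ outerBoundary G U) ∧ x ∉ U'} with hS
  have hYS : ∀ y ∈ insert v (outerBoundary G U), y ∈ S := by
    intro y hy
    rcases Finset.mem_insert.1 hy with rfl | hy
    · exact ⟨Or.inl hvU, hvU'⟩
    · exact ⟨Or.inr hy, fun h => (mem_outerBoundary.1 hy).1 (hU'U h)⟩
  have hPS : ∀ y ∈ insert v (outerBoundary G U), P y ⊆ S := fun y hy =>
    subset_of_connected_restrictEdges (hP y hy).1 (hP y hy).2.2.1 (hYS y hy)
  choose! ρ hρP hρZ using fun y hy => (hP y hy).2.1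
  have hρimage : (insert v (outerBoundary G U)).image ρ = outerBoundary G U' := by
    refine Finset.eq_of_subset_of_card_le (Finset.image_subset_iff.2 hρZ) ?_
    rw [Finset.card_image_of_injOn, hYcard, hU'card]
    intro y hy z hz hyz
    by_contra hne
    exact Set.disjoint_left.1 (hPdis y hy z hz hne) (hρP y hy) (hyz ▸ hρP z hz)
  have hroot : ∀ j < i, root j ∈ insert v (outerBoundary G U) := fun j hj =>
    Finset.mem_insert_of_mem ((hM.mem_outerBoundary_iff _).2 ⟨j, hj, rfl⟩)
  have hvY : v ∈ insert v (outerBoundary G U) := Finset.mem_insert_self _ _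
  set root₁ : ℕ → W := fun j => if j < i then root j else v with hroot₁
  have hr_lt : ∀ j < i, root₁ j = root j := fun j hj => by simp [hroot₁, hj]
  have hr_i : root₁ i = v := by simp [hroot₁]
  have hr_mem : ∀ j, root₁ j ∈ insert v (outerBoundary G U) := by
    intro j
    by_cases hj : j < i
    · rw [hr_lt j hj]; exact hroot j hj
    · simp [hroot₁, hj]
  have hr_ne : ∀ j < i + 1, ∀ k < i + 1, j ≠ k → root₁ j ≠ root₁ k := by
    have h1 : ∀ j < i, root j ≠ v := fun j hj h =>
      hvX (h ▸ (hM.mem_outerBoundary_iff _).2 ⟨j, hj, rfl⟩)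
    intro j hj k hk hjk
    rcases Nat.lt_succ_iff_lt_or_eq.1 hj with hj | rfl <;>
      rcases Nat.lt_succ_iff_lt_or_eq.1 hk with hk | rfl
    · rw [hr_lt j hj, hr_lt k hk]
      exact fun h => Set.disjoint_left.1 (hM.disjoint j hj k hk hjk) (hM.root_mem j hj)
        (h ▸ hM.root_mem k hk)
    · rw [hr_lt j hj, hr_i]; exact h1 j hj
    · rw [hr_lt k hk, hr_i]; exact (h1 k hk).symm
    · exact absurd rfl hjk
  set M' : ℕ → Set W := fun j => if j < i then M j ∪ P (root j) else P v with hM'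
  have hM'_lt : ∀ j < i, M' j = M j ∪ P (root j) := fun j hj => by simp [hM', hj]
  have hM'_i : M' i = P v := by simp [hM']
  have hMP : ∀ j < i, ∀ y ∈ insert v (outerBoundary G U), root j ≠ y → Disjoint (M j) (P y) := by
    intro j hj y hy hne
    rw [Set.disjoint_left]
    intro x hx hxP
    have hxX := (hPS y hy hxP).1.resolve_left (hM.notMem j hj x hx)
    obtain ⟨k, hk, rfl⟩ := (hM.mem_outerBoundary_iff x).1 hxX
    by_cases hjk : j = k
    · subst hjk
      exact hne ((hP y hy).2.2.2 _ (hroot j hj) hxP)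
    · exact Set.disjoint_left.1 (hM.disjoint j hj k hk hjk) hx (hM.root_mem k hk)
  have hdis_i : ∀ j < i, Disjoint (M' j) (M' i) := by
    intro j hj
    have h1 := hr_ne j (by omega) i (by omega) hj.ne
    rw [hr_lt j hj, hr_i] at h1
    rw [hM'_lt j hj, hM'_i, Set.disjoint_union_left]
    exact ⟨hMP j hj v hvY h1, hPdis _ (hroot j hj) v hvY h1⟩
  refine ⟨U', M', fun j => ρ (root₁ j), ⟨hbU', hU'card, fun U'' hsub => hU'min U'' hsub⟩,
    ⟨?_, ?_, ?_, ?_, ?_, ?_⟩⟩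
  · intro j hj
    rcases Nat.lt_succ_iff_lt_or_eq.1 hj with hj | rfl
    · rw [hM'_lt j hj]
      exact connected_union (hM.connected j hj)
        (connected_mono (restrictEdges_le _ _) (hP _ (hroot j hj)).1) (hM.root_mem j hj)
        (hP _ (hroot j hj)).2.2.1 (Or.inl rfl)
    · rw [hM'_i]
      exact connected_mono (restrictEdges_le _ _) (hP v hvY).1
  · intro j hj
    rcases Nat.lt_succ_iff_lt_or_eq.1 hj with hj | rfl
    · rw [hM'_lt j hj]
      simp only [hr_lt j hj]
      exact Or.inr (hρP _ (hroot j hj))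
    · rw [hM'_i]
      simp only [hr_i]
      exact hρP v hvY
  · intro j hj k hk hjk
    rcases Nat.lt_succ_iff_lt_or_eq.1 hj with hj | rfl <;>
      rcases Nat.lt_succ_iff_lt_or_eq.1 hk with hk | rfl
    · have h1 := hr_ne j (by omega) k (by omega) hjk
      rw [hr_lt j hj, hr_lt k hk] at h1
      rw [hM'_lt j hj, hM'_lt k hk, Set.disjoint_union_left, Set.disjoint_union_right,
        Set.disjoint_union_right]
      exact ⟨⟨hM.disjoint j hj k hk hjk, hMP j hj _ (hroot k hk) h1⟩,
        (hMP k hk _ (hroot j hj) h1.symm).symm, hPdis _ (hroot j hj) _ (hroot k hk) h1⟩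
    · exact hdis_i j hj
    · exact (hdis_i k hk).symm
    · exact absurd rfl hjk
  · intro j hj x hx
    rcases Nat.lt_succ_iff_lt_or_eq.1 hj with hj | rfl
    · rw [hM'_lt j hj] at hx
      rcases hx with hx | hx
      · exact fun h => hM.notMem j hj x hx (hU'U h)
      · exact (hPS _ (hroot j hj) hx).2
    · rw [hM'_i] at hx
      exact (hPS v hvY hx).2
  · intro w
    rw [← hρimage, Finset.mem_image]
    constructor
    · rintro ⟨y, hy, rfl⟩
      rcases Finset.mem_insert.1 hy with rfl | hy
      · exact ⟨i, by omega, by rw [hr_i]⟩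
      · obtain ⟨j, hj, rfl⟩ := (hM.mem_outerBoundary_iff _).1 hy
        exact ⟨j, by omega, by rw [hr_lt j hj]⟩
    · rintro ⟨j, -, rfl⟩
      exact ⟨_, hr_mem j, rfl⟩
  · intro j hj k hk
    have hkj := hpar j k hk
    rcases Nat.lt_succ_iff_lt_or_eq.1 hj with hj | rfl
    · obtain ⟨a, ha, b, hb, hab⟩ := hM.exists_adj j hj k hk
      rw [hM'_lt j hj, hM'_lt k (by omega)]
      exact ⟨a, Or.inl ha, b, Or.inl hb, hab⟩
    · rw [hM'_i, hM'_lt k hkj]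
      exact ⟨v, (hP v hvY).2.2.1, root k, Or.inl (hM.root_mem k hkj), hv k hk⟩

theorem exists_isRootedModel {𝓑 : Finset (Finset W)} (h𝓑 : IsBramble G 𝓑) {par : ℕ → Option ℕ}
    (hpar : ∀ j k, par j = some k → k < j) (i : ℕ)
    (hord : ∀ X : Finset W, X.card ≤ i → ∃ b ∈ 𝓑, ∀ x ∈ b, x ∉ X) :
    ∃ U M root, IsTight G 𝓑 U i ∧ IsRootedModel G par U i M root := by
  induction i with
  | zero =>
    obtain ⟨b, hb, -⟩ := hord ∅ (by simp)
    obtain ⟨⟨a, -⟩⟩ := (h𝓑.1 b hb).nonempty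
    obtain ⟨U, -, hU, hc, hmin⟩ := exists_minimal_card_outerBoundary_le (G := G) (𝓑 := 𝓑)
      (U := Finset.univ) (i := 0) ⟨b, hb, Finset.subset_univ _⟩
      (by simp [Finset.eq_empty_iff_forall_notMem, mem_outerBoundary])
    refine ⟨U, fun _ => ∅, fun _ => a, ⟨hU, by omega, hmin⟩, ?_⟩
    have : outerBoundary G U = ∅ := by simpa using hc
    exact ⟨by simp, by simp, by simp, by simp, by simp [this], by simp⟩
  | succ i ih =>
    obtain ⟨U, M, root, hU, hM⟩ := ih fun X hX => hord X (by omega)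
    exact hM.succ h𝓑 hpar hU hord

/-- Two disjoint rooted models of size `n`, outside a connected set `U`, together with disjoint
connected subsets of `U`, each adjacent to one member of each model. -/
theorem exists_linked_models {n : ℕ} (hn : 1 ≤ n) {par : ℕ → Option ℕ}
    (hpar : ∀ j k, par j = some k → k < j) (htw : 3 * n - 1 ≤ treewidth G) :
    ∃ (U : Set W) (M I : ℕ → Set W) (σ : ℕ → ℕ), (G.induce U).Connected ∧
      (∀ j < 2 * n, (G.induce (M j)).Connected ∧ Disjoint (M j) U) ∧
      (∀ j < 2 * n, ∀ k < 2 * n, j ≠ k → Disjoint (M j) (M k)) ∧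
      (∀ j < 2 * n, ∀ k, par j = some k → ∃ a ∈ M j, ∃ b ∈ M k, G.Adj a b) ∧
      (∀ j < n, (G.induce (I j)).Connected ∧ I j ⊆ U ∧ σ j < n ∧
        (∃ a ∈ I j, ∃ b ∈ M j, G.Adj a b) ∧ ∃ a ∈ I j, ∃ b ∈ M (n + σ j), G.Adj a b) ∧
      ∀ j < n, ∀ k < n, j ≠ k → Disjoint (I j) (I k) ∧ σ j ≠ σ k := by
  classical
  obtain ⟨𝓑, h𝓑, hord⟩ := exists_isBramble_of_lt_treewidth (by omega) htw
  obtain ⟨U, M, root, hU, hM⟩ := exists_isRootedModel h𝓑 hpar (2 * n)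
    fun X hX => hord X (by omega)
  have hinj : ∀ j < 2 * n, ∀ k < 2 * n, root j = root k → j = k := by
    intro j hj k hk h
    by_contra hne
    exact Set.disjoint_left.1 (hM.disjoint j hj k hk hne) (hM.root_mem j hj) (h ▸ hM.root_mem k hk)
  have hbU : ∀ j < 2 * n, root j ∈ outerBoundary G U := fun j hj =>
    (hM.mem_outerBoundary_iff _).2 ⟨j, hj, rfl⟩
  have hrU : ∀ j < 2 * n, root j ∉ U := fun j hj => (mem_outerBoundary.1 (hbU j hj)).1
  set Y := (Finset.range n).image root with hY
  set Z := (Finset.range n).image fun j => root (n + j) with hZ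
  have hYc : Y.card = n := by
    rw [hY, Finset.card_image_of_injOn, Finset.card_range]
    intro j hj k hk h
    simp only [Finset.coe_range, Set.mem_Iio] at hj hk
    exact hinj j (by omega) k (by omega) h
  have hZc : Z.card = n := by
    rw [hZ, Finset.card_image_of_injOn, Finset.card_range]
    intro j hj k hk h
    simp only [Finset.coe_range, Set.mem_Iio] at hj hk
    have := hinj (n + j) (by omega) (n + k) (by omega) h
    omega
  have hYZ : outerBoundary G U = Y ∪ Z := by
    ext w
    simp only [hM.mem_outerBoundary_iff, hY, hZ, Finset.mem_union, Finset.mem_image,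
      Finset.mem_range]
    constructor
    · rintro ⟨j, hj, rfl⟩
      by_cases hjn : j < n
      · exact Or.inl ⟨j, hjn, rfl⟩
      · exact Or.inr ⟨j - n, by omega, by congr 1; omega⟩
    · rintro (⟨j, hj, rfl⟩ | ⟨j, hj, rfl⟩)
      · exact ⟨j, by omega, rfl⟩
      · exact ⟨n + j, by omega, rfl⟩
  obtain ⟨P, hP, hPdis⟩ := (hU.linked_halves h𝓑 hord hYZ hYc hZc).symm.exists_indexed hYc
  choose! ρ hρP hρZ using fun y hy => (hP y hy).2.1
  have hρinj : ∀ y ∈ Y, ∀ z ∈ Y, ρ y = ρ z → y = z := by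
    intro y hy z hz hyz
    by_contra hne
    exact Set.disjoint_left.1 (hPdis y hy z hz hne) (hρP y hy) (hyz ▸ hρP z hz)
  have hρimage : Y.image ρ = Z := by
    refine Finset.eq_of_subset_of_card_le (Finset.image_subset_iff.2 hρZ) ?_
    rw [Finset.card_image_of_injOn hρinj, hYc, hZc]
  have hPX : ∀ y ∈ Y, ∀ x ∈ P y, x ∈ outerBoundary G U → x = y ∨ x = ρ y := by
    intro y hy x hx hxX
    rw [hYZ, Finset.mem_union] at hxX
    rcases hxX with hxY | hxZ
    · exact Or.inl ((hP y hy).2.2.2 x hxY hx)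
    · rw [← hρimage, Finset.mem_image] at hxZ
      obtain ⟨z, hz, rfl⟩ := hxZ
      by_cases hyz : y = z
      · exact Or.inr (by rw [hyz])
      · exact absurd (hρP z hz) (Set.disjoint_left.1 (hPdis y hy z hz hyz) hx)
  have hYmem : ∀ j < n, root j ∈ Y := fun j hj =>
    Finset.mem_image.2 ⟨j, Finset.mem_range.2 hj, rfl⟩
  have hσ : ∀ j, ∃ s, j < n → s < n ∧ root (n + s) = ρ (root j) := by
    intro j
    by_cases hj : j < n
    · obtain ⟨s, hs, hs'⟩ := Finset.mem_image.1 (hρZ _ (hYmem j hj))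
      exact ⟨s, fun _ => ⟨Finset.mem_range.1 hs, hs'⟩⟩
    · exact ⟨0, fun h => absurd h hj⟩
  choose σ hσ using hσ
  have hI : ∀ j, ∃ D : Set W, j < n → D ⊆ P (root j) ∧ D ⊆ U ∧ (G.induce D).Connected ∧
      (∃ a ∈ D, G.Adj a (root j)) ∧ ∃ a ∈ D, G.Adj a (ρ (root j)) := by
    intro j
    by_cases hj : j < n
    swap
    · exact ⟨∅, fun h => absurd h hj⟩
    set y := root j with hy
    have hyY := hYmem j hj
    have hyU : y ∉ U := hrU j (by omega)
    have hρU : ρ y ∉ U := by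
      rw [← (hσ j hj).2]
      exact hrU _ (by have := (hσ j hj).1; omega)
    have hne : y ≠ ρ y := fun h => by
      rw [← (hσ j hj).2] at h
      have := hinj j (by omega) _ (by have := (hσ j hj).1; omega) h
      omega
    obtain ⟨D₁, hD₁P, hyD₁, hD₁c, c, hcD₁, hcρ⟩ := exists_connected_avoiding (hP y hyY).1
      (hP y hyY).2.2.1 (hρP y hyY) hne
    have hcU : c ∈ U := hcρ.2.2.2.1.resolve_right hρU
    obtain ⟨D, hD, hcD, hDc, d, hdD, hdy⟩ := exists_connected_avoiding hD₁c hcD₁ hyD₁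
      (fun h => hyU (h ▸ hcU))
    have hDP : D ⊆ P y := fun x hx => (hD₁P (hD hx).1).1
    have hPS : P y ⊆ ↑U ∪ ↑(outerBoundary G U) :=
      subset_of_connected_restrictEdges (hP y hyY).1 (hP y hyY).2.2.1
        (Or.inr (hbU j (by omega)))
    refine ⟨D, fun _ => ⟨hDP, fun x hx => ?_, connected_mono (restrictEdges_le _ _) hDc,
      ⟨d, hdD, hdy.1⟩, c, hcD, hcρ.1⟩⟩
    refine (hPS (hDP hx)).resolve_right fun hxX => ?_
    rcases hPX y hyY x (hDP hx) hxX with h | h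
    · exact (hD hx).2 h
    · exact (hD₁P (hD hx).1).2 h
  choose I hI using hI
  refine ⟨U, M, I, σ, hU.connected h𝓑, fun j hj => ⟨hM.connected j hj,
    Set.disjoint_left.2 (hM.notMem j hj)⟩, hM.disjoint, hM.exists_adj, ?_, ?_⟩
  · intro j hj
    obtain ⟨-, hIU, hIc, ⟨a, ha, haj⟩, b, hb, hbj⟩ := hI j hj
    refine ⟨hIc, hIU, (hσ j hj).1, ⟨a, ha, _, hM.root_mem j (by omega), haj⟩, b, hb, _,
      hM.root_mem _ (by have := (hσ j hj).1; omega), ?_⟩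
    rwa [(hσ j hj).2]
  · intro j hj k hk hjk
    have hne : root j ≠ root k := fun h => hjk (hinj j (by omega) k (by omega) h)
    refine ⟨(hPdis _ (hYmem j hj) _ (hYmem k hk) hne).mono (hI j hj).1 (hI k hk).1, fun h => ?_⟩
    refine hne (hρinj _ (hYmem j hj) _ (hYmem k hk) ?_)
    rw [← (hσ j hj).2, ← (hσ k hk).2, h]

end Boundary

section PathOrStar

theorem SimpleGraph.Connected.exists_parent {ι : Type*} {Q : SimpleGraph ι} (hQ : Q.Connected)
    (r : ι) : ∃ par : ι → ι, ∀ x, x ≠ r → Q.Adj x (par x) ∧ Q.dist r (par x) + 1 = Q.dist r x := by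
  have key : ∀ x, ∃ y, x ≠ r → Q.Adj x y ∧ Q.dist r y + 1 = Q.dist r x := by
    intro x
    by_cases hx : x = r
    · exact ⟨x, fun h => absurd hx h⟩
    obtain ⟨w, hw⟩ := hQ.exists_walk_length_eq_dist x r
    cases w with
    | nil => exact absurd rfl hx
    | @cons _ y _ h w' =>
      refine ⟨y, fun _ => ⟨h, ?_⟩⟩
      rw [SimpleGraph.dist_comm (u := r) (v := y), SimpleGraph.dist_comm (u := r) (v := x)]
      rw [SimpleGraph.Walk.length_cons] at hw
      have h1 := SimpleGraph.dist_le w'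
      have h2 := hQ.dist_triangle (u := x) (v := y) (w := r)
      rw [SimpleGraph.dist_eq_one_iff_adj.2 h] at h2
      omega
  choose par hpar using key
  exact ⟨par, hpar⟩

/-- A connected graph on more than `(p - 1) ^ 2` vertices contains a path on `p` vertices or a
spanning tree with `p` leaves. -/
theorem exists_path_or_spanning_star {ι : Type*} [Fintype ι] {Q : SimpleGraph ι} (hQ : Q.Connected)
    {p : ℕ} (hp : p ^ 2 < Fintype.card ι) :
    (∃ f : ℕ → ι, (∀ i < p + 1, ∀ j < p + 1, f i = f j → i = j) ∧ ∀ i < p, Q.Adj (f i) (f (i + 1))) ∨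
    ∃ L : Finset ι, p + 1 ≤ L.card ∧ (Q.induce {x | x ∉ L}).Connected ∧
      ∀ x ∈ L, ∃ y, y ∉ L ∧ Q.Adj x y := by
  classical
  obtain ⟨r⟩ := hQ.nonempty
  obtain ⟨par, hpar⟩ := hQ.exists_parent r
  have hpos : ∀ x, 0 < Q.dist r x → x ≠ r := by
    rintro x hx rfl
    simp at hx
  by_cases hlong : ∃ x, p ≤ Q.dist r x
  · left
    obtain ⟨x, hx⟩ := hlong
    have hdist : ∀ i ≤ p, Q.dist r (par^[i] x) + i = Q.dist r x := by
      intro i hi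
      induction i with
      | zero => rfl
      | succ i ih =>
        have h1 := ih (by omega)
        have h2 := (hpar (par^[i] x) (hpos _ (by omega))).2
        rw [Function.iterate_succ_apply']
        omega
    refine ⟨fun i => par^[i] x, fun i hi j hj hij => ?_, fun i hi => ?_⟩
    · have h1 := hdist i (by omega)
      have h2 := hdist j (by omega)
      simp only at hij
      rw [hij] at h1
      omega
    · simp only [Function.iterate_succ_apply']
      have h1 := hdist i (by omega)
      exact (hpar _ (hpos _ (by omega))).1
  · right
    push Not at hlong
    set L : Finset ι := Finset.univ.filter fun x => x ≠ r ∧ ∀ y, y ≠ r → par y ≠ x with hL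
    have hmem : ∀ x, x ∈ L ↔ x ≠ r ∧ ∀ y, y ≠ r → par y ≠ x := by simp [hL]
    have hparL : ∀ x, x ≠ r → par x ∉ L := fun x hx h => ((hmem _).1 h).2 x hx rfl
    refine ⟨L, ?_, ?_, fun x hx => ⟨par x, hparL x ((hmem x).1 hx).1, (hpar x ((hmem x).1 hx).1).1⟩⟩
    · have hleaf : ∀ x, ∃ y, x ≠ r → y ∈ L ∧ par^[Q.dist r y - Q.dist r x] y = x := by
        intro x
        obtain ⟨y, ⟨k, hk, hky⟩, hy⟩ := (Set.toFinite {y | ∃ k, par^[k] y = x ∧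
          Q.dist r y = Q.dist r x + k}).exists_maximalFor (fun y => Q.dist r y) _ ⟨x, 0, rfl, rfl⟩
        refine ⟨y, fun hx => ⟨(hmem y).2 ⟨?_, ?_⟩, ?_⟩⟩
        · have := hQ.pos_dist_of_ne hx.symm
          exact hpos _ (by omega)
        · rintro z hz rfl
          have h1 := (hpar z hz).2
          have := hy (j := z) ⟨k + 1, by rw [Function.iterate_succ_apply, hk], by omega⟩
            (by simp only; omega)
          simp only at this
          omega
        · rw [hky, Nat.add_sub_cancel_left, hk]
      choose leaf hleaf using hleaf
      have hcard : (Finset.univ.erase r).card ≤ (L ×ˢ Finset.Icc 1 (p - 1)).card := by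
        refine Finset.card_le_card_of_injOn (fun x => (leaf x, Q.dist r x)) ?_ ?_
        · intro x hx
          have hx : x ≠ r := by simpa using hx
          have h1 := hQ.pos_dist_of_ne hx.symm
          have h2 := hlong x
          simp only [Finset.coe_product, Set.mem_prod, Finset.mem_coe, Finset.mem_Icc]
          exact ⟨(hleaf x hx).1, by omega, by omega⟩
        · intro x hx y hy hxy
          have hx : x ≠ r := by simpa using hx
          have hy : y ≠ r := by simpa using hy
          simp only [Prod.mk.injEq] at hxy
          rw [← (hleaf x hx).2, ← (hleaf y hy).2, hxy.1, hxy.2]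
      rw [Finset.card_erase_of_mem (Finset.mem_univ r), Finset.card_univ, Finset.card_product,
        Nat.card_Icc] at hcard
      have hp0 := hlong r
      obtain ⟨q, rfl⟩ : ∃ q, p = q + 1 := ⟨p - 1, by omega⟩
      by_contra! hlt
      simp only [Nat.add_sub_cancel] at hcard
      have : L.card * q ≤ (q + 1) * q := Nat.mul_le_mul_right q (by omega)
      have h3 : (q + 1) ^ 2 ≤ Fintype.card ι - 1 := by omega
      nlinarith
    · refine connected_of_forall_closed (a := r) (by simp [hmem]) fun R hrR hR => ?_
      have : ∀ d x, Q.dist r x = d → x ∉ L → x ∈ R := by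
        intro d
        induction d with
        | zero =>
          intro x hx _
          rwa [← (hQ.dist_eq_zero_iff.1 hx)]
        | succ d ih =>
          intro x hx hxL
          have hxr := hpos x (by omega)
          have h1 := hpar x hxr
          exact hR (par x) (ih _ (by omega) (hparL x hxr)) (hparL x hxr) x hxL h1.1.symm
      exact fun x hx => this _ x rfl hx

theorem exists_enumeration_of_injOn {ι : Type*} (L : Finset ι) (s : ι → ℕ)
    (hs : ∀ x ∈ L, ∀ y ∈ L, s x = s y → x = y) :
    ∃ f : Fin L.card → ι, (∀ i, f i ∈ L) ∧ ∀ i j, i < j → s (f i) < s (f j) := by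
  classical
  have hc : (L.image s).card = L.card := Finset.card_image_of_injOn hs
  have h : ∀ i, ∃ x ∈ L, s x = (L.image s).orderEmbOfFin hc i := fun i =>
    Finset.mem_image.1 ((L.image s).orderEmbOfFin_mem hc i)
  choose f hf hfs using h
  refine ⟨f, hf, fun i j hij => ?_⟩
  rw [hfs, hfs]
  exact ((L.image s).orderEmbOfFin hc).strictMono hij

variable {W : Type*} {G : SimpleGraph W}

/-- Disjoint connected subsets of a connected set `U` extend to a partition of `U` into connected
sets. -/
theorem exists_connected_partition [Finite W] {ι : Type*} [Finite ι] [Nonempty ι] {U : Set W}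
    (hU : (G.induce U).Connected) {I : ι → Set W} (hI : ∀ x, (G.induce (I x)).Connected)
    (hIU : ∀ x, I x ⊆ U) (hdis : Pairwise fun x y => Disjoint (I x) (I y)) :
    ∃ J : ι → Set W, (∀ x, I x ⊆ J x) ∧ (∀ x, (G.induce (J x)).Connected) ∧ (∀ x, J x ⊆ U) ∧
      (Pairwise fun x y => Disjoint (J x) (J y)) ∧ ∀ w ∈ U, ∃ x, w ∈ J x := by
  classical
  obtain ⟨J, hIJ, hJ⟩ := (Set.toFinite {J : ι → Set W | (∀ x, (G.induce (J x)).Connected) ∧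
    (∀ x, J x ⊆ U) ∧ Pairwise fun x y => Disjoint (J x) (J y)}).exists_le_maximal
    (a := I) ⟨hI, hIU, hdis⟩
  obtain ⟨hJc, hJU, hJd⟩ := hJ.prop
  refine ⟨J, hIJ, hJc, hJU, hJd, ?_⟩
  by_contra! hcon
  obtain ⟨w, hwU, hw⟩ := hcon
  obtain ⟨x₀⟩ := ‹Nonempty ι›
  obtain ⟨⟨a, ha⟩⟩ := (hJc x₀).nonempty
  obtain ⟨u, x, hux, v, hvU, hv, huv⟩ : ∃ u x, u ∈ J x ∧ ∃ v ∈ U, (∀ y, v ∉ J y) ∧ G.Adj u v := by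
    by_contra! hcl
    have : U ⊆ {v | ∃ x, v ∈ J x} := subset_of_connected_of_closed hU (hJU x₀ ha) ⟨x₀, ha⟩ (by
      rintro u ⟨x, hux⟩ _ v hvU huv
      by_contra hv
      exact hcl u x hux v hvU (fun y hy => hv ⟨y, hy⟩) huv)
    obtain ⟨x, hx⟩ := this hwU
    exact hw x hx
  have hle : J ≤ Function.update J x (insert v (J x)) := by
    intro y
    by_cases hy : y = x
    · subst hy
      simp
    · simp [hy]
  have := hJ.le_of_ge (y := Function.update J x (insert v (J x))) ⟨?_, ?_, ?_⟩ hle x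
  · simp only [Function.update_self] at this
    exact hv x (this (Set.mem_insert _ _))
  · intro y
    by_cases hy : y = x
    · subst hy
      rw [Function.update_self]
      exact connected_insert (hJc y) hux huv
    · rw [Function.update_of_ne hy]
      exact hJc y
  · intro y
    by_cases hy : y = x
    · subst hy
      rw [Function.update_self]
      exact Set.insert_subset hvU (hJU y)
    · rw [Function.update_of_ne hy]
      exact hJU y
  · intro y z hyz
    by_cases hy : y = x
    · subst hy
      rw [Function.update_self, Function.update_of_ne hyz.symm, Set.disjoint_insert_left]
      exact ⟨hv z, hJd hyz⟩
    · rw [Function.update_of_ne hy]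
      by_cases hz : z = x
      · subst hz
        rw [Function.update_self, Set.disjoint_insert_right]
        exact ⟨hv y, hJd hyz⟩
      · rw [Function.update_of_ne hz]
        exact hJd hyz

/-- The graph obtained by contracting the sets `J x`. -/
def quotientGraph (G : SimpleGraph W) {ι : Type*} (J : ι → Set W) : SimpleGraph ι :=
  SimpleGraph.fromRel fun x y => ∃ a ∈ J x, ∃ b ∈ J y, G.Adj a b

theorem quotientGraph_adj {ι : Type*} {J : ι → Set W} {x y : ι} :
    (quotientGraph G J).Adj x y ↔ x ≠ y ∧ ∃ a ∈ J x, ∃ b ∈ J y, G.Adj a b := by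
  rw [quotientGraph, SimpleGraph.fromRel_adj]
  refine and_congr_right fun _ => ⟨?_, Or.inl⟩
  rintro (h | ⟨a, ha, b, hb, hab⟩)
  exacts [h, ⟨b, hb, a, ha, hab.symm⟩]

theorem connected_quotientGraph {ι : Type*} [Nonempty ι] {U : Set W} (hU : (G.induce U).Connected)
    {J : ι → Set W} (hJ : ∀ x, (G.induce (J x)).Connected) (hJU : ∀ x, J x ⊆ U)
    (hJd : Pairwise fun x y => Disjoint (J x) (J y)) (hcov : ∀ w ∈ U, ∃ x, w ∈ J x) :
    (quotientGraph G J).Connected := by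
  refine ⟨fun x y => ?_⟩
  obtain ⟨⟨a, ha⟩⟩ := (hJ x).nonempty
  obtain ⟨⟨b, hb⟩⟩ := (hJ y).nonempty
  have hsub : U ⊆ {w | ∃ z, w ∈ J z ∧ (quotientGraph G J).Reachable x z} :=
    subset_of_connected_of_closed hU (hJU x ha) ⟨x, ha, .refl x⟩ (by
      rintro u ⟨z, huz, hxz⟩ _ v hvU huv
      obtain ⟨z', hvz'⟩ := hcov v hvU
      refine ⟨z', hvz', ?_⟩
      by_cases hzz' : z = z'
      · rwa [← hzz']
      · exact hxz.trans (quotientGraph_adj.2 ⟨hzz', u, huz, v, hvz', huv⟩).reachable)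
  obtain ⟨z, hbz, hxz⟩ := hsub (hJU y hb)
  by_cases hyz : y = z
  · rwa [hyz]
  · exact absurd hbz (Set.disjoint_left.1 (hJd hyz) hb)

end PathOrStar

section Assembly

variable {V W : Type*} {T : SimpleGraph V} {G : SimpleGraph W}

/-- An enumeration of a tree in which every edge joins a vertex to its parent, an earlier vertex,
followed by an infinite path. -/
theorem SimpleGraph.IsTree.exists_enumeration [Fintype V] (hT : T.IsTree) :
    ∃ (e : V → ℕ) (par : ℕ → Option ℕ), Function.Injective e ∧ (∀ v, e v < Fintype.card V) ∧
      (∀ j k, par j = some k → k < j) ∧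
      (∀ u v, T.Adj u v → par (e u) = some (e v) ∨ par (e v) = some (e u)) ∧
      ∀ j, par (Fintype.card V + (j + 1)) = some (Fintype.card V + j) := by
  classical
  obtain ⟨r⟩ := hT.connected.nonempty
  obtain ⟨parent, hparent⟩ := hT.connected.exists_parent r
  set e₀ := (Fintype.equivFin V).symm
  set τ := Tuple.sort fun i => T.dist r (e₀ i)
  set E : Fin (Fintype.card V) ≃ V := τ.trans e₀
  have hmono : Monotone fun i => T.dist r (E i) := Tuple.monotone_sort fun i => T.dist r (e₀ i)
  have hedge : (Finset.univ.erase r).image (fun v => s(v, parent v)) = T.edgeFinset := by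
    refine Finset.eq_of_subset_of_card_le ?_ ?_
    · intro x hx
      obtain ⟨v, hv, rfl⟩ := Finset.mem_image.1 hx
      simpa using (hparent v (Finset.ne_of_mem_erase hv)).1
    · rw [Finset.card_image_of_injOn, Finset.card_erase_of_mem (Finset.mem_univ r),
        Finset.card_univ, ← hT.card_edgeFinset, Nat.add_sub_cancel]
      intro u hu v hv huv
      have h1 := (hparent u (Finset.ne_of_mem_erase hu)).2
      have h2 := (hparent v (Finset.ne_of_mem_erase hv)).2
      simp only [Sym2.eq_iff] at huv
      rcases huv with h | ⟨h, h'⟩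
      · exact h.1
      · rw [← h] at h2
        rw [h'] at h1
        omega
  refine ⟨fun v => (E.symm v : ℕ), fun j => if hj : j < Fintype.card V then
    (if E ⟨j, hj⟩ = r then none else some (E.symm (parent (E ⟨j, hj⟩)) : ℕ)) else
    (if j = Fintype.card V then none else some (j - 1)), ?_, fun v => (E.symm v).2, ?_, ?_, ?_⟩
  · exact fun u v huv => E.symm.injective (Fin.ext huv)
  · intro j k hjk
    by_cases hj : j < Fintype.card V
    · by_cases hr : E ⟨j, hj⟩ = r
      · simp [hj, hr] at hjk
      · simp only [hj, hr, dif_pos, if_false, Option.some.injEq] at hjk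
        have h1 := (hparent _ hr).2
        by_contra! hle
        have h2 : (⟨j, hj⟩ : Fin _) ≤ E.symm (parent (E ⟨j, hj⟩)) := by
          rw [Fin.le_def, hjk]
          exact hle
        have h3 := hmono h2
        simp only [Equiv.apply_symm_apply] at h3
        omega
    · by_cases hj' : j = Fintype.card V
      · simp [hj'] at hjk
      · simp only [hj, hj', dif_neg, not_false_eq_true, if_false, Option.some.injEq] at hjk
        omega
  · intro u v huv
    have hmem : s(u, v) ∈ (Finset.univ.erase r).image (fun v => s(v, parent v)) := by
      rw [hedge]
      simpa using huv
    obtain ⟨w, hw, hwe⟩ := Finset.mem_image.1 hmem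
    have hw := Finset.ne_of_mem_erase hw
    rcases Sym2.eq_iff.1 hwe with ⟨rfl, rfl⟩ | ⟨rfl, rfl⟩
    · left
      simp [hw]
    · right
      simp [hw]
  · intro j
    beta_reduce
    rw [dif_neg (by omega), if_neg (by omega)]
    rfl

theorem isMinor_lambdaGraph {N : V → Set W} {p : ℕ} {m : Fin p → V} {A : Fin p → Set W} {B : Set W}
    (hN : ∀ v, (G.induce (N v)).Connected) (hA : ∀ i, (G.induce (A i)).Connected)
    (hB : (G.induce B).Connected) (hNN : ∀ u v, u ≠ v → Disjoint (N u) (N v))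
    (hAA : ∀ i j, i < j → Disjoint (A i) (A j)) (hNA : ∀ v i, Disjoint (N v) (A i))
    (hNB : ∀ v, Disjoint (N v) B) (hAB : ∀ i, Disjoint (A i) B)
    (hT : ∀ u v, T.Adj u v → ∃ a ∈ N u, ∃ b ∈ N v, G.Adj a b)
    (hpath : ∀ i j : Fin p, (j : ℕ) = i + 1 → ∃ a ∈ A i, ∃ b ∈ A j, G.Adj a b)
    (hm : ∀ i, ∃ a ∈ N (m i), ∃ b ∈ A i, G.Adj a b)
    (hnew : ∀ i, ∃ a ∈ B, ∃ b ∈ A i, G.Adj a b) : IsMinor (lambdaGraph T p m) G := by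
  refine ⟨Sum.elim N fun o => o.elim B A, ?_, ?_, ?_⟩
  · rintro (v | _ | i)
    exacts [hN v, hB, hA i]
  · rintro (u | _ | i) (v | _ | j) hne
    · exact hNN u v (by simpa using hne)
    · exact hNB u
    · exact hNA u j
    · exact (hNB v).symm
    · exact absurd rfl hne
    · exact (hAB j).symm
    · exact (hNA v i).symm
    · exact hAB i
    · have hij : i ≠ j := by simpa using hne
      rcases lt_or_gt_of_ne hij with h | h
      exacts [hAA i j h, (hAA j i h).symm]
  · have hsymm : ∀ S S' : Set W, (∃ a ∈ S, ∃ b ∈ S', G.Adj a b) → ∃ a ∈ S', ∃ b ∈ S, G.Adj a b :=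
      fun _ _ ⟨a, ha, b, hb, hab⟩ => ⟨b, hb, a, ha, hab.symm⟩
    have key : ∀ u v : V ⊕ Option (Fin p), (match u, v with
        | Sum.inl a, Sum.inl b => T.Adj a b
        | Sum.inr (some i), Sum.inr (some j) => (j : ℕ) = (i : ℕ) + 1
        | Sum.inr none, Sum.inr (some _) => True
        | Sum.inl a, Sum.inr (some i) => m i = a
        | _, _ => False) → ∃ a ∈ Sum.elim N (fun o => o.elim B A) u,
        ∃ b ∈ Sum.elim N (fun o => o.elim B A) v, G.Adj a b := by
      rintro (u | _ | i) (v | _ | j) h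
      · exact hT u v h
      · exact h.elim
      · obtain rfl : m j = u := h
        exact hm j
      · exact h.elim
      · exact h.elim
      · exact hnew j
      · exact h.elim
      · exact h.elim
      · exact hpath i j h
    intro u v huv
    rw [lambdaGraph, SimpleGraph.fromRel_adj] at huv
    rcases huv.2 with h | h
    · exact key u v h
    · exact hsymm _ _ (key v u h)

/-- The union of the sets `M j` over `a ≤ j ≤ b`. -/
def unionIcc (M : ℕ → Set W) (a b : ℕ) : Set W :=
  {w | ∃ j, a ≤ j ∧ j ≤ b ∧ w ∈ M j}

theorem connected_unionIcc {M : ℕ → Set W} {a b : ℕ} (hab : a ≤ b)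
    (hM : ∀ j, a ≤ j → j ≤ b → (G.induce (M j)).Connected)
    (hadj : ∀ j, a ≤ j → j < b → ∃ x ∈ M (j + 1), ∃ y ∈ M j, G.Adj x y) :
    (G.induce (unionIcc M a b)).Connected := by
  induction b, hab using Nat.le_induction with
  | base =>
    have : unionIcc M a a = M a := by
      ext w
      constructor
      · rintro ⟨j, h1, h2, h3⟩
        rwa [le_antisymm h1 h2]
      · exact fun h => ⟨a, le_rfl, le_rfl, h⟩
    rw [this]
    exact hM a le_rfl le_rfl
  | succ b hab ih =>
    have : unionIcc M a (b + 1) = unionIcc M a b ∪ M (b + 1) := by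
      ext w
      constructor
      · rintro ⟨j, h1, h2, h3⟩
        rcases Nat.le_succ_iff.1 h2 with h | rfl
        exacts [Or.inl ⟨j, h1, h, h3⟩, Or.inr h3]
      · rintro (⟨j, h1, h2, h3⟩ | h)
        exacts [⟨j, h1, by omega, h3⟩, ⟨b + 1, by omega, le_rfl, h⟩]
    rw [this]
    obtain ⟨x, hx, y, hy, hxy⟩ := hadj b hab (by omega)
    exact connected_union (ih (fun j h1 h2 => hM j h1 (by omega))
      fun j h1 h2 => hadj j h1 (by omega)) (hM _ (by omega) le_rfl) ⟨b, hab, le_rfl, hy⟩ hx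
      (Or.inr hxy.symm)

end Assembly

/-- If `T` is a tree on `n ≥ 1` vertices and `tw(G) ≥ 3n - 1`, then `G` contains as a
minor some member of `Λ(T)`, i.e. the disjoint union of `T`, a path `P` on
`p ≥ √|L(T)|` vertices and a vertex `v_new` joined to all of `P`, together with `p`
pairwise disjoint edges between the vertices of `P` and the leaves of `T`. -/
theorem lambdaGraph_minor_of_treewidth {V : Type*} [Fintype V] (n : ℕ) (hn : 1 ≤ n)
    (T : SimpleGraph V) (hT : T.IsTree) (hcard : Fintype.card V = n)
    {W : Type*} [Fintype W] (G : SimpleGraph W) (htw : treewidth G ≥ 3 * n - 1) :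
    ∃ (p : ℕ) (m : Fin p → V),
      Function.Injective m ∧
      (∀ i, IsLeaf T (m i)) ∧
      Real.sqrt (Set.ncard {v : V | IsLeaf T v}) ≤ (p : ℝ) ∧
      IsMinor (lambdaGraph T p m) G := by
  classical
  subst hcard
  obtain ⟨e, par, he, hen, hpar, hTe, hparP⟩ := hT.exists_enumeration
  set n := Fintype.card V with hn'
  obtain ⟨U, M, I, σ, hU, hM, hMd, hMadj, hI, hId⟩ := exists_linked_models hn hpar htw
  have hN : ∀ v, (G.induce (M (e v))).Connected := fun v => (hM _ (by have := hen v; omega)).1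
  have hNU : ∀ v, Disjoint (M (e v)) U := fun v => (hM _ (by have := hen v; omega)).2
  have hNN : ∀ u v, u ≠ v → Disjoint (M (e u)) (M (e v)) := fun u v huv =>
    hMd _ (by have := hen u; omega) _ (by have := hen v; omega) fun h => huv (he h)
  have hTadj : ∀ u v, T.Adj u v → ∃ a ∈ M (e u), ∃ b ∈ M (e v), G.Adj a b := by
    intro u v huv
    rcases hTe u v huv with h | h
    · exact hMadj _ (by have := hen u; omega) _ h
    · obtain ⟨a, ha, b, hb, hab⟩ := hMadj _ (by have := hen v; omega) _ h
      exact ⟨b, hb, a, ha, hab.symm⟩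
  set R : ℕ → ℕ → Set W := unionIcc fun j => M (n + j)
  have hRadj : ∀ j, j + 1 < n → ∃ a ∈ M (n + (j + 1)), ∃ b ∈ M (n + j), G.Adj a b := fun j hj =>
    hMadj _ (by omega) _ (hparP j)
  have hRc : ∀ a b, a ≤ b → b < n → (G.induce (R a b)).Connected := fun a b hab hb =>
    connected_unionIcc hab (fun j _ hj => (hM _ (by omega)).1) fun j _ hj => hRadj j (by omega)
  have hRU : ∀ a b, b < n → Disjoint (R a b) U := by
    rintro a b hb
    rw [Set.disjoint_left]
    rintro w ⟨j, -, hj, hw⟩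
    exact Set.disjoint_left.1 (hM _ (by omega)).2 hw
  have hNR : ∀ v a b, b < n → Disjoint (M (e v)) (R a b) := by
    rintro v a b hb
    rw [Set.disjoint_left]
    rintro w hv ⟨j, -, hj, hw⟩
    have := hen v
    exact Set.disjoint_left.1 (hMd (e v) (by omega) (n + j) (by omega) (by omega)) hv hw
  have hncard : Set.ncard {v : V | IsLeaf T v} = Fintype.card {v : V // IsLeaf T v} := by
    rw [← Nat.card_eq_fintype_card]
    rfl
  have hsqrt : ∀ p : ℕ, Fintype.card {v : V // IsLeaf T v} ≤ p ^ 2 →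
      Real.sqrt (Set.ncard {v : V | IsLeaf T v}) ≤ (p : ℝ) := by
    intro p hp
    rw [hncard]
    exact Real.sqrt_le_iff.2 ⟨by positivity, by exact_mod_cast hp⟩
  rcases isEmpty_or_nonempty {v : V // IsLeaf T v} with hempty | hnonempty
  · refine ⟨0, Fin.elim0, fun i => i.elim0, fun i => i.elim0, hsqrt 0 (by simp), ?_⟩
    exact isMinor_lambdaGraph (A := fun i => i.elim0) hN (fun i => i.elim0)
      (hRc 0 0 le_rfl hn) hNN (fun i => i.elim0) (fun _ i => i.elim0) (fun v => hNR v 0 0 hn)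
      (fun i => i.elim0) hTadj (fun i => i.elim0) (fun i => i.elim0) (fun i => i.elim0)
  have hxn : ∀ x : {v : V // IsLeaf T v}, e x < n := fun x => hen x
  have hσn : ∀ x : {v : V // IsLeaf T v}, σ (e x) < n := fun x => (hI _ (hxn x)).2.2.1
  have hex : ∀ x y : {v : V // IsLeaf T v}, x ≠ y → e x ≠ e y := fun x y hxy h =>
    hxy (Subtype.ext (he h))
  obtain ⟨J, hIJ, hJ, hJU, hJd, hJcov⟩ := exists_connected_partition
    (I := fun x : {v : V // IsLeaf T v} => I (e x)) hU (fun x => (hI _ (hxn x)).1)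
    (fun x => (hI _ (hxn x)).2.1)
    (fun x y hxy => (hId _ (hxn x) _ (hxn y) (hex x y hxy)).1)
  have hJN : ∀ v x, Disjoint (M (e v)) (J x) := fun v x => (hNU v).mono_right (hJU x)
  have hJR : ∀ x a b, b < n → Disjoint (J x) (R a b) := fun x a b hb =>
    ((hRU a b hb).mono_right (hJU x)).symm
  have hJadjN : ∀ x : {v : V // IsLeaf T v}, ∃ a ∈ M (e x), ∃ b ∈ J x, G.Adj a b := by
    intro x
    obtain ⟨a, ha, b, hb, hab⟩ := (hI _ (hxn x)).2.2.2.1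
    exact ⟨b, hb, a, hIJ x ha, hab.symm⟩
  have hJadjR : ∀ (x : {v : V // IsLeaf T v}) (a b : ℕ), a ≤ σ (e x) → σ (e x) ≤ b →
      ∃ u ∈ R a b, ∃ w ∈ J x, G.Adj u w := by
    intro x a b ha hb
    obtain ⟨u, hu, w, hw, huw⟩ := (hI _ (hxn x)).2.2.2.2
    exact ⟨w, ⟨_, ha, hb, hw⟩, u, hIJ x hu, huw.symm⟩
  have hQ := connected_quotientGraph hU hJ hJU hJd hJcov
  obtain ⟨p, hp, hp'⟩ : ∃ p, p ^ 2 < Fintype.card {v : V // IsLeaf T v} ∧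
      Fintype.card {v : V // IsLeaf T v} ≤ (p + 1) ^ 2 := by
    have hpos : 0 < Fintype.card {v : V // IsLeaf T v} := Fintype.card_pos
    refine ⟨Nat.sqrt (Fintype.card {v : V // IsLeaf T v} - 1), ?_, ?_⟩
    · have := Nat.sqrt_le' (Fintype.card {v : V // IsLeaf T v} - 1)
      omega
    · have := Nat.lt_succ_sqrt' (Fintype.card {v : V // IsLeaf T v} - 1)
      rw [Nat.succ_eq_add_one] at this
      omega
  rcases exists_path_or_spanning_star hQ hp with ⟨f, hfinj, hfadj⟩ | ⟨L, hLcard, hLc, hLadj⟩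
  · refine ⟨p + 1, fun i => f i, fun i j hij => Fin.ext (hfinj i i.2 j j.2 (Subtype.ext hij)),
      fun i => (f i).2, hsqrt _ hp', ?_⟩
    refine isMinor_lambdaGraph (A := fun i => J (f i)) (B := R 0 (n - 1)) hN (fun i => hJ _)
      (hRc _ _ (by omega) (by omega)) hNN ?_ (fun v i => hJN v _) (fun v => hNR v _ _ (by omega))
      (fun i => hJR _ _ _ (by omega)) hTadj ?_ (fun i => hJadjN _) (fun i => hJadjR (f i) 0 (n - 1)
        (Nat.zero_le _) (by have := hσn (f i); omega))
    · exact fun i j hij => hJd fun h => hij.ne (Fin.ext (hfinj i i.2 j j.2 h))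
    · intro i j hij
      rw [hij]
      exact (quotientGraph_adj.1 (hfadj i (by omega))).2
  · obtain ⟨f, hfL, hfmono⟩ := exists_enumeration_of_injOn L (fun x => σ (e x)) (by
      intro x _ y _ hxy
      by_contra hne
      exact (hId _ (hxn x) _ (hxn y) (hex x y hne)).2 hxy)
    have hfinj : Function.Injective f := by
      intro i j hij
      by_contra hne
      rcases lt_or_gt_of_ne hne with h | h <;> have := hfmono _ _ h <;> simp [hij] at this
    set lo : Fin L.card → ℕ := fun i => if h : (i : ℕ) = 0 then 0 else
      σ (e (f ⟨i - 1, by omega⟩)) + 1 with hlo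
    have hlo_le : ∀ i, lo i ≤ σ (e (f i)) := by
      intro i
      by_cases h : (i : ℕ) = 0
      · simp [hlo, h]
      · simp only [hlo, h, dite_false]
        exact hfmono _ _ (by rw [Fin.lt_def]; simp only; omega)
    have hlo_succ : ∀ i j : Fin L.card, (j : ℕ) = i + 1 → lo j = σ (e (f i)) + 1 := by
      intro i j hij
      have h : (j : ℕ) ≠ 0 := by omega
      have h' : (⟨(j : ℕ) - 1, by omega⟩ : Fin L.card) = i := Fin.ext (by simp only; omega)
      simp only [hlo, h, dite_false, h']
    have hlo_lt : ∀ i j : Fin L.card, i < j → σ (e (f i)) < lo j := by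
      intro i j hij
      rw [Fin.lt_def] at hij
      have h1 := hlo_succ ⟨(j : ℕ) - 1, by omega⟩ j (by simp only; omega)
      rw [h1]
      rcases (show i ≤ ⟨(j : ℕ) - 1, by omega⟩ by rw [Fin.le_def]; simp only; omega).lt_or_eq with h | h
      · have := hfmono _ _ h
        omega
      · exact Nat.lt_succ_of_le (le_of_eq (congrArg (fun i => σ (e (f i))) h))
    set S : Fin L.card → Set W := fun i => R (lo i) (σ (e (f i)))
    have hSc : ∀ i, (G.induce (S i)).Connected := fun i => hRc _ _ (hlo_le i) (hσn _)
    have hSS : ∀ i j, i < j → Disjoint (S i) (S j) := by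
      intro i j hij
      rw [Set.disjoint_left]
      rintro w ⟨k, -, hk, hw⟩ ⟨l, hl, hl', hw'⟩
      have h1 := hlo_lt i j hij
      have h2 := hσn (f j)
      exact Set.disjoint_left.1 (hMd (n + k) (by omega) (n + l) (by omega) (by omega)) hw hw'
    set B : Set W := ⋃ x ∈ {x | x ∉ L}, J x with hB
    have hBJ : ∀ x ∈ L, Disjoint (J x) B := by
      intro x hx
      simp only [hB, Set.disjoint_iUnion_right]
      exact fun y hy => hJd fun h => hy (h ▸ hx)
    have hBU : B ⊆ U := Set.iUnion₂_subset fun x _ => hJU x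
    refine ⟨L.card, fun i => f i, fun i j hij => hfinj (Subtype.ext hij), fun i => (f i).2,
      hsqrt _ (hp'.trans (Nat.pow_le_pow_left hLcard 2)), ?_⟩
    refine isMinor_lambdaGraph (A := fun i => S i ∪ J (f i)) (B := B) hN ?_ ?_ hNN ?_ ?_ ?_ ?_ hTadj
      ?_ ?_ ?_
    · intro i
      obtain ⟨u, hu, w, hw, huw⟩ := hJadjR (f i) _ _ (hlo_le i) le_rfl
      exact connected_union (hSc i) (hJ _) hu hw (Or.inr huw)
    · exact connected_biUnion hLc (fun x _ => hJ x) fun x _ y _ hxy =>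
        let ⟨a, ha, b, hb, hab⟩ := (quotientGraph_adj.1 hxy).2
        ⟨a, ha, b, hb, Or.inr hab⟩
    · intro i j hij
      rw [Set.disjoint_union_left, Set.disjoint_union_right, Set.disjoint_union_right]
      exact ⟨⟨hSS i j hij, (hJR _ _ _ (hσn _)).symm⟩, hJR _ _ _ (hσn _),
        hJd fun h => hij.ne (hfinj h)⟩
    · intro v i
      rw [Set.disjoint_union_right]
      exact ⟨hNR _ _ _ (hσn _), hJN _ _⟩
    · exact fun v => (hNU v).mono_right hBU
    · intro i
      rw [Set.disjoint_union_left]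
      exact ⟨(hRU _ _ (hσn _)).mono_right hBU, hBJ _ (hfL i)⟩
    · intro i j hij
      have h1 := hlo_succ i j hij
      have h2 := hlo_le j
      have h3 := hσn (f j)
      obtain ⟨a, ha, b, hb, hab⟩ := hRadj (σ (e (f i))) (by omega)
      exact ⟨b, Or.inl ⟨_, hlo_le i, le_rfl, hb⟩, a, Or.inl ⟨_, h1.le, by omega, ha⟩, hab.symm⟩
    · intro i
      obtain ⟨a, ha, b, hb, hab⟩ := hJadjN (f i)
      exact ⟨a, ha, b, Or.inr hb, hab⟩
    · intro i
      obtain ⟨y, hyL, hy⟩ := hLadj (f i) (hfL i)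
      obtain ⟨-, a, ha, b, hb, hab⟩ := quotientGraph_adj.1 hy
      exact ⟨b, Set.mem_biUnion hyL hb, a, Or.inr ha, hab.symm⟩
end

section
/- Let ℓ > 0 be an integer and let G be a finite simple graph with tw(G) ≥ 3ℓ − 1. Then G contains as a minor a graph of the following form: a path P = p_1 p_2 … p_{2ℓ} together with a family Q of ℓ pairwise vertex-disjoint paths of length 2 (each internally disjoint from P) such that every vertex of P is an endpoint of exactly one path of Q, and every path of Q has one endpoint in {p_1, …, p_ℓ} and the other endpoint in {p_{ℓ+1}, …, p_{2ℓ}}. -/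
/-- The graph formed by a path `p_1 … p_(2ℓ)` (the `inl` vertices) together with a
family of `ℓ` pairwise vertex-disjoint paths of length 2, the `j`-th of which joins
the first-half vertex `p_(j+1)` to the second-half vertex `p_(ℓ+σ(j)+1)` through the
internal vertex `inr j`; in particular every vertex of the path is the endpoint of
exactly one of the length-2 paths. -/
def linkedPath (ℓ : ℕ) (σ : Fin ℓ ≃ Fin ℓ) : SimpleGraph (Fin (2 * ℓ) ⊕ Fin ℓ) :=
  SimpleGraph.fromRel (fun u v =>
    match u, v with
    | Sum.inl i, Sum.inl j => (j : ℕ) = (i : ℕ) + 1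
    | Sum.inl i, Sum.inr j => (i : ℕ) = (j : ℕ) ∨ (i : ℕ) = ℓ + (σ j : ℕ)
    | _, _ => False)

namespace SimpleGraph

theorem IsTree.sum_sup_edge {α β : Type*} [Finite α] [Finite β] {s : SimpleGraph α}
    {t : SimpleGraph β} (hs : s.IsTree) (ht : t.IsTree) (a : α) (b : β) :
    (s.sum t ⊔ edge (.inl a) (.inr b)).IsTree := by
  classical
  rw [isTree_iff_connected_and_card] at hs ht ⊢
  refine ⟨hs.1.sum_sup_edge ht.1, ?_⟩
  have hab : s((Sum.inl a : α ⊕ β), .inr b) ∉ (s.sum t).edgeSet := by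
    simp [mem_edgeSet]
  rw [edgeSet_sup, edgeSet_edge_of_ne (by simp), Set.union_singleton, Nat.card_coe_set_eq,
    Set.ncard_insert_of_notMem hab, ← Nat.card_coe_set_eq, Nat.card_congr edgeSetSumEquiv,
    Nat.card_sum, Nat.card_sum, ← hs.2, ← ht.2]
  omega

theorem Connected.induce_image {α β : Type*} {s : SimpleGraph α} {t : SimpleGraph β}
    (f : s →g t) {A : Set α} (h : (s.induce A).Connected) : (t.induce (f '' A)).Connected :=
  h.map (induceHom f (Set.mapsTo_image f A)) (Set.surjective_mapsTo_image_restrict f A)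

end SimpleGraph

/-- `G.induce B` has a tree decomposition with bags of size at most `n`, one of which contains
`X`. -/
def HasRootedTreeDecomp {V : Type*} (G : SimpleGraph V) (n : ℕ) (B X : Finset V) : Prop :=
  ∃ (ι : Type) (_ : Fintype ι) (t : SimpleGraph ι) (bag : ι → Finset V) (r : ι),
    t.IsTree ∧
    (∀ i, bag i ⊆ B) ∧
    (∀ u ∈ B, ∀ v ∈ B, G.Adj u v → ∃ i, u ∈ bag i ∧ v ∈ bag i) ∧
    (∀ v ∈ B, (t.induce {i : ι | v ∈ bag i}).Connected) ∧
    (∀ i, (bag i).card ≤ n) ∧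
    X ⊆ bag r

open SimpleGraph

namespace HasRootedTreeDecomp

variable {V : Type*} {G : SimpleGraph V} {n : ℕ} {B X : Finset V}

theorem of_card_le (h : B.card ≤ n) : HasRootedTreeDecomp G n B B := by
  refine ⟨Unit, inferInstance, ⊥, fun _ => B, (), .of_subsingleton, fun _ => subset_rfl,
    fun u hu v hv _ => ⟨(), hu, hv⟩, fun v hv => ?_, fun _ => h, subset_rfl⟩
  have : Nonempty {i : Unit | v ∈ B} := ⟨⟨(), hv⟩⟩
  exact IsTree.of_subsingleton.connected

theorem anti {Y : Finset V} (h : HasRootedTreeDecomp G n B X) (hY : Y ⊆ X) :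
    HasRootedTreeDecomp G n B Y := by
  obtain ⟨ι, hι, t, bag, r, h1, h2, h3, h4, h5, h6⟩ := h
  exact ⟨ι, hι, t, bag, r, h1, h2, h3, h4, h5, hY.trans h6⟩

theorem treewidth_le [Fintype V] (h : HasRootedTreeDecomp G (n + 1) Finset.univ X) :
    treewidth G ≤ n := by
  obtain ⟨ι, hι, t, bag, r, h1, h2, h3, h4, h5, h6⟩ := h
  refine Nat.sInf_le ⟨ι, hι, t, bag, h1, fun v => ?_, fun u v => h3 u (by simp) v (by simp),
    fun v => h4 v (by simp), h5⟩
  obtain ⟨i⟩ := (h4 v (by simp)).nonempty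
  exact ⟨i.1, i.2⟩

theorem glue [DecidableEq V] {B₁ B₂ X₁ X₂ : Finset V} (h₁ : HasRootedTreeDecomp G n B₁ X₁)
    (h₂ : HasRootedTreeDecomp G n B₂ X₂) (hX₁ : B₁ ∩ B₂ ⊆ X₁) (hX₂ : B₁ ∩ B₂ ⊆ X₂)
    (hadj : ∀ u ∈ B₁ \ B₂, ∀ v ∈ B₂ \ B₁, ¬ G.Adj u v) :
    HasRootedTreeDecomp G n (B₁ ∪ B₂) X₂ := by
  obtain ⟨ι, hι, s, bag, r, h1, h2, h3, h4, h5, h6⟩ := h₁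
  obtain ⟨κ, hκ, t, gab, q, k1, k2, k3, k4, k5, k6⟩ := h₂
  let f : s →g (s.sum t ⊔ edge (.inl r) (.inr q)) :=
    (Hom.ofLE le_sup_left).comp Embedding.sumInl.toHom
  let g : t →g (s.sum t ⊔ edge (.inl r) (.inr q)) :=
    (Hom.ofLE le_sup_left).comp Embedding.sumInr.toHom
  refine ⟨ι ⊕ κ, inferInstance, s.sum t ⊔ edge (.inl r) (.inr q), Sum.elim bag gab, .inr q,
    h1.sum_sup_edge k1 r q, ?_, ?_, ?_, ?_, k6⟩
  · rintro (i | i)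
    · exact (h2 i).trans Finset.subset_union_left
    · exact (k2 i).trans Finset.subset_union_right
  · intro u hu v hv huv
    by_cases h₁ : u ∈ B₁ ∧ v ∈ B₁
    · obtain ⟨i, hi⟩ := h3 u h₁.1 v h₁.2 huv
      exact ⟨.inl i, hi⟩
    by_cases h₂ : u ∈ B₂ ∧ v ∈ B₂
    · obtain ⟨i, hi⟩ := k3 u h₂.1 v h₂.2 huv
      exact ⟨.inr i, hi⟩
    have := hadj u
    have := hadj v
    grind [SimpleGraph.Adj.symm]
  · intro v hv
    have hset : {i : ι ⊕ κ | v ∈ Sum.elim bag gab i} =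
        f '' {i | v ∈ bag i} ∪ g '' {i | v ∈ gab i} := by
      ext (i | i) <;> simp [f, g]
    rw [hset]
    by_cases hv₁ : v ∈ B₁ <;> by_cases hv₂ : v ∈ B₂
    · have hv' : v ∈ B₁ ∩ B₂ := by simp [hv₁, hv₂]
      exact connected_induce_union ((h4 v hv₁).induce_image f).preconnected
        ((k4 v hv₂).induce_image g).preconnected ⟨r, h6 (hX₁ hv'), rfl⟩ ⟨q, k6 (hX₂ hv'), rfl⟩
        (Or.inr (by simp [f, g, edge_adj]))
    · have : {i | v ∈ gab i} = ∅ := by ext i; simpa using fun h => hv₂ (k2 i h)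
      rw [this, Set.image_empty, Set.union_empty]
      exact (h4 v hv₁).induce_image f
    · have : {i | v ∈ bag i} = ∅ := by ext i; simpa using fun h => hv₁ (h2 i h)
      rw [this, Set.image_empty, Set.empty_union]
      exact (k4 v hv₂).induce_image g
    · simp [hv₁, hv₂] at hv
  · rintro (i | i)
    · exact h5 i
    · exact k5 i

end HasRootedTreeDecomp

namespace SimpleGraph

variable {V ι : Type*} {H H' : SimpleGraph V} {A B L R : Finset V} {k : ℕ}

/-- The spanning subgraph whose edges are the edges of `H` with both ends in `L`. -/
def restrictTo (H : SimpleGraph V) (L : Finset V) : SimpleGraph V where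
  Adj u v := H.Adj u v ∧ u ∈ L ∧ v ∈ L
  symm := ⟨fun _ _ h => ⟨h.1.symm, h.2.2, h.2.1⟩⟩
  loopless := ⟨fun _ h => h.1.ne rfl⟩

theorem restrictTo_le : H.restrictTo L ≤ H := fun _ _ h => h.1

theorem subset_of_connected_restrictTo {C : Set V} (hC : ((H.restrictTo L).induce C).Connected)
    {c : V} (hc : c ∈ C) (hcL : c ∈ L) : C ⊆ L := by
  intro v hv
  obtain ⟨p⟩ := hC.preconnected ⟨c, hc⟩ ⟨v, hv⟩
  generalize hx : (⟨c, hc⟩ : C) = x, hy : (⟨v, hv⟩ : C) = y at p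
  have hxL : (x : V) ∈ L := hx ▸ hcL
  have hyL : (y : V) ∈ L := by
    clear hx hy
    induction p with
    | nil => exact hxL
    | cons h _ ih => exact ih h.2.2
  simpa [← hy] using hyL

/-- The pair `(L, R)` is a separation of `H`: the two sides cover the vertices and no edge joins
`L \ R` to `R \ L`. -/
def IsSeparation (H : SimpleGraph V) (L R : Finset V) : Prop :=
  (∀ v, v ∈ L ∨ v ∈ R) ∧ ∀ u v, u ∉ R → v ∉ L → ¬ H.Adj u v

theorem IsSeparation.symm (h : H.IsSeparation L R) : H.IsSeparation R L :=
  ⟨fun v => (h.1 v).symm, fun u v hu hv huv => h.2 v u hv hu huv.symm⟩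

/-- The sets `C i` are disjoint and connected, and each has exactly one vertex in `A` and exactly
one vertex in `B`. -/
structure IsLinkage (H : SimpleGraph V) (A B : Finset V) (C : ι → Set V) : Prop where
  connected : ∀ i, (H.induce (C i)).Connected
  disjoint : Pairwise fun i j => Disjoint (C i) (C j)
  left : ∀ i, ∃ a, C i ∩ A = {a}
  right : ∀ i, ∃ b, C i ∩ B = {b}

namespace IsLinkage

variable {C : ι → Set V}

theorem symm (h : H.IsLinkage A B C) : H.IsLinkage B A C :=
  ⟨h.connected, h.disjoint, h.right, h.left⟩

theorem mono (h : H.IsLinkage A B C) (hH : H ≤ H') : H'.IsLinkage A B C :=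
  ⟨fun i => (h.connected i).mono fun _ _ hu => hH hu, h.disjoint, h.left, h.right⟩

theorem eq_of_mem (h : H.IsLinkage A B C) {v : V} {i j : ι} (hi : v ∈ C i) (hj : v ∈ C j) :
    i = j := by
  by_contra hij
  exact Set.disjoint_left.1 (h.disjoint hij) hi hj

theorem exists_equiv_right [Fintype ι] (h : H.IsLinkage A B C) (hB : B.card = Fintype.card ι) :
    ∃ e : ι ≃ B, ∀ i, C i ∩ B = {(e i : V)} := by
  choose b hb using h.right
  have hbC : ∀ i, b i ∈ C i ∩ B := fun i => by simp [hb]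
  let f : ι → B := fun i => ⟨b i, (hbC i).2⟩
  have hf : Function.Bijective f := by
    rw [Fintype.bijective_iff_injective_and_card]
    refine ⟨fun i j hij => h.eq_of_mem (hbC i).1 ?_, by simp [hB]⟩
    have : b i = b j := congrArg Subtype.val hij
    exact this ▸ (hbC j).1
  exact ⟨.ofBijective f hf, hb⟩

end IsLinkage

theorem IsSeparation.le_card_of_restrictTo [DecidableEq V] {x y : V}
    (hLR : H'.IsSeparation L R) (hA : A ⊆ L) (hB : B ⊆ R)
    (hsep : ∀ L R, H.IsSeparation L R → A ⊆ L → B ⊆ R → k ≤ (L ∩ R).card)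
    (hH : ∀ u v, H.Adj u v → H'.Adj u v ∨ (u = x ∧ v = y) ∨ (u = y ∧ v = x)) (hy : y ∉ L)
    {L₁ R₁ : Finset V} (h₁ : (H'.restrictTo L).IsSeparation L₁ R₁) (hA₁ : A ⊆ L₁)
    (hR₁ : insert x (L ∩ R) ⊆ R₁) : k ≤ (L₁ ∩ R₁).card := by
  refine (hsep (L₁ ∩ L) (R₁ ∪ R) ⟨fun v => ?_, fun u v hu hv huv => ?_⟩
    (Finset.subset_inter hA₁ hA) (hB.trans Finset.subset_union_right)).trans
    (Finset.card_le_card ?_)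
  · have := hLR.1 v
    have := h₁.1 v
    grind
  · have h₁uv := h₁.2 u v
    have h₂uv := hLR.2 u v
    have := hLR.1 u
    have := h₁.1 u
    have : x ∈ R₁ := hR₁ (by simp)
    simp only [restrictTo] at h₁uv
    grind
  · intro v hv
    have : v ∈ L ∩ R → v ∈ R₁ := fun h => hR₁ (by simp [Finset.mem_inter.1 h])
    grind

/-- Menger's theorem. -/
theorem exists_isLinkage [Fintype V] (H : SimpleGraph V) (A B : Finset V) (k : ℕ)
    [DecidableEq V]
    (hsep : ∀ L R, H.IsSeparation L R → A ⊆ L → B ⊆ R → k ≤ (L ∩ R).card) :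
    ∃ C : Fin k → Set V, H.IsLinkage A B C := by
  induction H using WellFoundedLT.induction generalizing A B with
  | _ H ih =>
  by_cases hbot : H = ⊥
  · subst hbot
    obtain ⟨S, hS, hSk⟩ := Finset.exists_subset_card_eq
      (hsep A (Aᶜ ∪ B) ⟨fun v => by grind [Finset.mem_compl], fun u v _ _ h => h⟩ subset_rfl
        Finset.subset_union_right)
    have hS' : ∀ v ∈ S, v ∈ A ∧ v ∈ B := fun v hv => by
      grind [Finset.mem_compl]
    let e := (S.equivFinOfCardEq hSk).symm
    refine ⟨fun i => {(e i : V)}, fun i => ?_, fun i j hij => ?_, fun i => ⟨e i, ?_⟩,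
      fun i => ⟨e i, ?_⟩⟩
    · exact connected_iff_exists_forall_reachable _ |>.2 ⟨⟨_, rfl⟩, by
        rintro ⟨w, rfl⟩; rfl⟩
    · simpa [Subtype.val_inj] using hij
    · simpa using (hS' _ (e i).2).1
    · simpa using (hS' _ (e i).2).2
  obtain ⟨a, b, hab⟩ := ne_bot_iff_exists_adj.1 hbot
  let H' := H.deleteEdges {s(a, b)}
  have hH'H : H' < H := by
    refine lt_of_le_of_ne (deleteEdges_le _) fun h => ?_
    have : H'.Adj a b := h ▸ hab
    simp [H'] at this
  by_cases hsep' : ∀ L R, H'.IsSeparation L R → A ⊆ L → B ⊆ R → k ≤ (L ∩ R).card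
  · obtain ⟨C, hC⟩ := ih H' hH'H A B hsep'
    exact ⟨C, hC.mono hH'H.le⟩
  push Not at hsep'
  obtain ⟨L, R, hLR, hA, hB, hlt⟩ := hsep'
  obtain ⟨x, y, hxR, hyL, hxy, hH⟩ : ∃ x y, x ∉ R ∧ y ∉ L ∧ H.Adj x y ∧
      ∀ u v, H.Adj u v → H'.Adj u v ∨ (u = x ∧ v = y) ∨ (u = y ∧ v = x) := by
    have hnot : ¬ H.IsSeparation L R := fun h => hlt.not_ge (hsep L R h hA hB)
    obtain ⟨x, y, hx, hy, hxy⟩ : ∃ x y, x ∉ R ∧ y ∉ L ∧ H.Adj x y := by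
      by_contra! h
      exact hnot ⟨hLR.1, fun u v hu hv => h u v hu hv⟩
    have hxy' := hLR.2 x y hx hy
    refine ⟨x, y, hx, hy, hxy, fun u v huv => ?_⟩
    simp only [H', deleteEdges_adj, Set.mem_singleton_iff, Sym2.eq_iff] at hxy' ⊢
    grind
  have hxL : x ∈ L := (hLR.1 x).resolve_right hxR
  have hyR : y ∈ R := (hLR.1 y).resolve_left hyL
  have hsymm : ∀ L R, H.IsSeparation L R → B ⊆ L → A ⊆ R → k ≤ (L ∩ R).card :=
    fun L R h h₁ h₂ => Finset.inter_comm R L ▸ hsep R L h.symm h₂ h₁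
  have hk : k = (L ∩ R).card + 1 := by
    refine le_antisymm ?_ hlt
    have hle := hsep L (insert x R) ⟨fun v => ?_, fun u v hu hv huv => ?_⟩ hA
      (hB.trans (Finset.subset_insert _ _))
    · rw [Finset.inter_insert_of_mem hxL] at hle
      exact hle.trans (Finset.card_insert_le _ _)
    · have := hLR.1 v
      grind
    · have := hLR.2 u v
      grind
  obtain ⟨C, hC⟩ := ih (H'.restrictTo L) (restrictTo_le.trans_lt hH'H) A (insert x (L ∩ R))
    fun L₁ R₁ h₁ => hLR.le_card_of_restrictTo hA hB hsep hH hyL h₁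
  obtain ⟨D, hD⟩ := ih (H'.restrictTo R) (restrictTo_le.trans_lt hH'H) B (insert y (R ∩ L))
    fun L₁ R₁ h₁ => hLR.symm.le_card_of_restrictTo hB hA hsymm
      (fun u v huv => (hH u v huv).imp_right Or.symm) hxR h₁
  obtain ⟨e, he⟩ := hC.exists_equiv_right (by
    rw [Finset.card_insert_of_notMem (by simp [hxR]), Fintype.card_fin, hk])
  obtain ⟨f, hf⟩ := hD.exists_equiv_right (by
    rw [Finset.card_insert_of_notMem (by simp [hyL]), Fintype.card_fin, hk, Finset.inter_comm])
  let g : V → V := fun v => if v = x then y else v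
  have hg : ∀ i, g (e i) ∈ insert y (R ∩ L) := fun i => by
    have := (e i).2
    grind
  let D' : Fin k → Set V := fun i => D (f.symm ⟨g (e i), hg i⟩)
  have hCT : ∀ i v, v ∈ C i → v ∈ insert x (L ∩ R) → v = e i := fun i v h₁ h₂ =>
    (he i).subset ⟨h₁, h₂⟩
  have hCe : ∀ i, (e i : V) ∈ C i := fun i => ((he i).superset rfl).1
  have hfD : ∀ i, D' i ∩ ↑(insert y (R ∩ L)) = {g (e i)} := fun i => by
    simp only [D', hf, Equiv.apply_symm_apply]
  have hDT : ∀ i v, v ∈ D' i → v ∈ insert y (R ∩ L) → v = g (e i) := fun i v h₁ h₂ =>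
    (hfD i).subset ⟨h₁, h₂⟩
  have hDe : ∀ i, g (e i) ∈ D' i := fun i => ((hfD i).superset rfl).1
  have hCL : ∀ i, C i ⊆ L := fun i =>
    subset_of_connected_restrictTo (hC.connected i) (hCe i) (by grind)
  have hDR : ∀ i, D' i ⊆ R := fun i =>
    subset_of_connected_restrictTo (hD.connected _) (hDe i) (by grind)
  have hcross : ∀ i j v, v ∈ C i → v ∈ D' j → v = e i ∧ v = e j := fun i j v hi hj => by
    have h₁ : v ∈ L := hCL i hi
    have h₂ : v ∈ R := hDR j hj
    have := hDT j v hj (by simp [h₁, h₂])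
    have := hCT i v hi (by simp [h₁, h₂])
    grind
  have hinj : ∀ i j, (e i : V) = e j → i = j := fun i j h => e.injective (Subtype.ext h)
  have hle : ∀ L, H'.restrictTo L ≤ H := fun L => restrictTo_le.trans hH'H.le
  have hCc := (hC.mono (hle L)).connected
  have hDc : ∀ i, (H.induce (D' i)).Connected := fun i => (hD.mono (hle R)).connected _
  refine ⟨fun i => C i ∪ D' i, fun i => ?_, fun i j hij => ?_, fun i => ?_, fun i => ?_⟩
  · by_cases hi : (e i : V) = x
    · exact connected_induce_union (hCc i).preconnected (hDc i).preconnected (hCe i) (hDe i)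
        (by simpa [g, hi] using hxy)
    · refine induce_union_connected (hCc i).preconnected (hDc i).preconnected ⟨e i, hCe i, ?_⟩
      simpa [g, hi] using hDe i
  · refine Set.disjoint_left.2 ?_
    rintro v (hi | hi) (hj | hj)
    · exact hij (hC.eq_of_mem hi hj)
    · have := hcross i j v hi hj
      grind
    · have := hcross j i v hj hi
      grind
    · have h₁ := hD.eq_of_mem hi hj
      have h₂ : g (e i) = g (e j) := by simpa using h₁
      have := (e i).2
      have := (e j).2
      grind
  · obtain ⟨c, hc⟩ := hC.left i
    refine ⟨c, hc ▸ Set.Subset.antisymm ?_ (by gcongr; exact Set.subset_union_left)⟩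
    rintro v ⟨hv | hv, hvA⟩
    · exact ⟨hv, hvA⟩
    · have h₁ : v ∈ L := hA hvA
      have h₂ : v ∈ R := hDR i hv
      have := hDT i v hv (by simp [h₁, h₂])
      have := hCe i
      refine ⟨?_, hvA⟩
      grind
  · obtain ⟨c, hc⟩ := hD.left (f.symm ⟨g (e i), hg i⟩)
    refine ⟨c, hc ▸ Set.Subset.antisymm ?_ (by gcongr; exact Set.subset_union_right)⟩
    rintro v ⟨hv | hv, hvB⟩
    · have h₁ : v ∈ L := hCL i hv
      have h₂ : v ∈ R := hB hvB
      have := hCT i v hv (by simp [h₁, h₂])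
      have := hDe i
      refine ⟨?_, hvB⟩
      change v ∈ D' i
      grind
    · exact ⟨hv, hvB⟩

end SimpleGraph

/-- `M 0, …, M (n - 1)` are the branch sets of a path minor of `G`; each of them contains at most
one vertex of `B`, and `X` is the set of vertices of `B` contained in one of them. -/
structure IsPathModel {V : Type*} (G : SimpleGraph V) (B X : Finset V) (n : ℕ) (M : ℕ → Set V) :
    Prop where
  connected : ∀ i < n, (G.induce (M i)).Connected
  disjoint : ∀ i < n, ∀ j < n, ∀ v, v ∈ M i → v ∈ M j → i = j
  adj : ∀ i, i + 1 < n → ∃ a ∈ M i, ∃ b ∈ M (i + 1), G.Adj a b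
  subsingleton : ∀ i < n, ∀ u v, u ∈ M i → v ∈ M i → u ∈ B → v ∈ B → u = v
  exists_mem : ∀ v ∈ X, ∃ i < n, v ∈ M i
  mem : ∀ i < n, ∀ v ∈ M i, v ∈ B → v ∈ X

theorem SimpleGraph.connected_induce_singleton {V : Type*} (G : SimpleGraph V) (v : V) :
    (G.induce {v}).Connected :=
  have : Nonempty ({v} : Set V) := ⟨⟨v, rfl⟩⟩
  IsTree.of_subsingleton.connected

namespace IsPathModel

variable {V : Type*} {G : SimpleGraph V} {B X : Finset V} {n : ℕ} {M : ℕ → Set V}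

theorem singleton (v : V) : IsPathModel G B {v} 1 fun _ => {v} where
  connected _ _ := G.connected_induce_singleton v
  disjoint := by omega
  adj := by omega
  subsingleton := by simp +contextual
  exists_mem w hw := ⟨0, by simpa using hw⟩
  mem := by simp

/-- Branch sets behind the last one that meets `X` can be dropped. -/
theorem exists_last (h : IsPathModel G B X n M) (hX : X.Nonempty) :
    ∃ m, ∃ x ∈ X, x ∈ M m ∧ IsPathModel G B X (m + 1) M := by
  induction n with
  | zero =>
    obtain ⟨x, hx⟩ := hX
    obtain ⟨i, hi, -⟩ := h.exists_mem x hx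
    omega
  | succ m ih =>
    by_cases hm : ∃ x ∈ X, x ∈ M m
    · obtain ⟨x, hx, hxm⟩ := hm
      exact ⟨m, x, hx, hxm, h⟩
    · push Not at hm
      refine ih ⟨fun i hi => h.connected i (by omega),
        fun i hi j hj => h.disjoint i (by omega) j (by omega), fun i hi => h.adj i (by omega),
        fun i hi => h.subsingleton i (by omega), fun v hv => ?_, fun i hi => h.mem i (by omega)⟩
      obtain ⟨i, hi, hiv⟩ := h.exists_mem v hv
      have : i ≠ m := fun him => hm v hv (him ▸ hiv)
      exact ⟨i, by omega, hiv⟩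

theorem snoc [DecidableEq V] {m : ℕ} {x v : V} (h : IsPathModel G B X (m + 1) M) (hx : x ∈ M m)
    (hv : v ∈ B) (hvX : v ∉ X) (hxv : G.Adj x v) :
    IsPathModel G B (insert v X) (m + 2) (Function.update M (m + 1) {v}) := by
  have hM : ∀ i < m + 1, Function.update M (m + 1) {v} i = M i := fun i hi =>
    Function.update_of_ne (by omega) _ _
  have hM' : Function.update M (m + 1) {v} (m + 1) = {v} := Function.update_self ..
  have hcase : ∀ i < m + 2, i < m + 1 ∨ i = m + 1 := fun i hi => by omega
  have hvM : ∀ i < m + 1, v ∉ M i := fun i hi hvi => hvX (h.mem i hi v hvi hv)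
  refine ⟨fun i hi => ?_, fun i hi j hj w hwi hwj => ?_, fun i hi => ?_,
    fun i hi u w hu hw => ?_, fun w hw => ?_, fun i hi w hw hwB => ?_⟩
  · obtain hi | rfl := hcase i hi
    · exact hM i hi ▸ h.connected i hi
    · rw [hM']
      exact G.connected_induce_singleton v
  · have := h.disjoint i
    obtain hi | rfl := hcase i hi <;> obtain hj | rfl := hcase j hj <;> grind
  · obtain hi' | hi' := hcase (i + 1) hi
    · rw [hM i (by omega), hM _ hi']
      exact h.adj i hi'
    · obtain rfl : i = m := by omega
      rw [hM i (by omega), hM']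
      exact ⟨x, hx, v, rfl, hxv⟩
  · have := h.subsingleton i
    obtain hi | rfl := hcase i hi <;> grind
  · obtain rfl | hw := Finset.mem_insert.1 hw
    · exact ⟨m + 1, by omega, by rw [hM']; rfl⟩
    · obtain ⟨i, hi, hiw⟩ := h.exists_mem w hw
      exact ⟨i, by omega, hM i hi ▸ hiw⟩
  · have := h.mem i
    obtain hi | rfl := hcase i hi <;> grind

theorem erase [DecidableEq V] (h : IsPathModel G B X n M) (x : V) :
    IsPathModel G (B.erase x) (X.erase x) n M where
  connected := h.connected
  disjoint := h.disjoint
  adj := h.adj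
  subsingleton i hi u v hu hv hu' hv' :=
    h.subsingleton i hi u v hu hv (Finset.mem_of_mem_erase hu') (Finset.mem_of_mem_erase hv')
  exists_mem v hv := h.exists_mem v (Finset.mem_of_mem_erase hv)
  mem i hi v hv hvB := by
    have := h.mem i hi v hv
    grind

/-- A branch set that does not meet `X` can be merged with one of its neighbours. -/
theorem merge {i : ℕ} (h : IsPathModel G B X (n + 1) M) (hi : i + 1 < n + 1)
    (hMi : (∀ x ∈ X, x ∉ M i) ∨ ∀ x ∈ X, x ∉ M (i + 1)) :
    IsPathModel G B X n
      fun j => if j < i then M j else if j = i then M i ∪ M (i + 1) else M (j + 1) := by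
  refine ⟨fun j hj => ?_, fun j hj k hk v hvj hvk => ?_, fun j hj => ?_,
    fun j hj u v hu hv huB hvB => ?_, fun v hv => ?_, fun j hj v hv hvB => ?_⟩
  · obtain h₁ | rfl | h₁ := lt_trichotomy j i
    · rw [if_pos h₁]
      exact h.connected j (by omega)
    · rw [if_neg (lt_irrefl j), if_pos rfl]
      obtain ⟨a, ha, b, hb, hab⟩ := h.adj j hi
      exact connected_induce_union (h.connected j (by omega)).preconnected
        (h.connected (j + 1) hi).preconnected ha hb hab
    · rw [if_neg h₁.not_gt, if_neg h₁.ne']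
      exact h.connected _ (by omega)
  · have hd : ∀ j < n + 1, ∀ k < n + 1, v ∈ M j → v ∈ M k → j = k := fun j hj k hk =>
      h.disjoint j hj k hk v
    split_ifs at hvj hvk <;> grind
  · obtain ⟨a, ha, b, hb, hab⟩ : ∃ a ∈ M (if j < i then j else j + 1),
        ∃ b ∈ M ((if j < i then j else j + 1) + 1), G.Adj a b :=
      h.adj _ (by split_ifs <;> omega)
    refine ⟨a, ?_, b, ?_, hab⟩
    · by_cases h₁ : j < i
      · simpa [h₁] using ha
      · by_cases h₂ : j = i
        · subst h₂
          simp at ha ⊢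
          exact Or.inr ha
        · simpa [h₁, h₂] using ha
    · by_cases h₁ : j + 1 < i
      · have : j < i := by omega
        simpa [h₁, this] using hb
      · by_cases h₂ : j + 1 = i
        · subst h₂
          simp at hb ⊢
          exact Or.inl hb
        · have : ¬ j < i := by omega
          simpa [h₁, h₂, this] using hb
  · have hs : ∀ j < n + 1, u ∈ M j → v ∈ M j → u = v := fun j hj h₁ h₂ =>
      h.subsingleton j hj u v h₁ h₂ huB hvB
    have hu' : ∀ j < n + 1, u ∈ M j → u ∈ X := fun j hj h₁ => h.mem j hj u h₁ huB
    have hv' : ∀ j < n + 1, v ∈ M j → v ∈ X := fun j hj h₁ => h.mem j hj v h₁ hvB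
    split_ifs at hu hv <;> grind
  · obtain ⟨j, hj, hvj⟩ := h.exists_mem v hv
    by_cases h₁ : j ≤ i
    · refine ⟨j, by omega, ?_⟩
      split_ifs with h₂ h₃
      · exact hvj
      · exact Or.inl (h₃ ▸ hvj)
      · omega
    · refine ⟨j - 1, by omega, ?_⟩
      have hj' : j - 1 + 1 = j := by omega
      split_ifs with h₂ h₃
      · omega
      · exact Or.inr (by rwa [← h₃, hj'])
      · rwa [hj']
  · have hm : ∀ j < n + 1, v ∈ M j → v ∈ X := fun j hj h₁ => h.mem j hj v h₁ hvB
    split_ifs at hv <;> grind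

theorem exists_forall_mem (h : IsPathModel G B X n M) :
    ∃ n M, IsPathModel G B X n M ∧ ∀ i < n, ∃ x ∈ X, x ∈ M i := by
  induction n generalizing M with
  | zero => exact ⟨0, M, h, by simp⟩
  | succ n ih =>
    by_cases hM : ∀ i < n + 1, ∃ x ∈ X, x ∈ M i
    · exact ⟨_, M, h, hM⟩
    push Not at hM
    obtain ⟨i, hi, hiX⟩ := hM
    rcases i with _ | i
    · rcases n with _ | n
      · refine ⟨0, M, ⟨by simp, by simp, by simp, by simp, fun v hv => ?_, by simp⟩, by simp⟩
        obtain ⟨j, hj, hvj⟩ := h.exists_mem v hv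
        obtain rfl : j = 0 := by omega
        exact absurd hvj (hiX v hv)
      · exact ih (h.merge (i := 0) (by omega) (Or.inl hiX))
    · exact ih (h.merge hi (Or.inr hiX))

theorem card_eq (h : IsPathModel G B X n M) (hX : X ⊆ B) (hM : ∀ i < n, ∃ x ∈ X, x ∈ M i) :
    X.card = n := by
  choose x hxX hxM using fun i : Fin n => hM i i.2
  have hx : (Finset.univ : Finset (Fin n)).card = X.card := by
    refine Finset.card_bij (fun i _ => x i) (fun i _ => hxX i) (fun i _ j _ hij => ?_)
      fun v hv => ?_
    · exact Fin.ext (h.disjoint i i.2 j j.2 _ (hxM i) (hij ▸ hxM j))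
    · obtain ⟨i, hi, hvi⟩ := h.exists_mem v hv
      exact ⟨⟨i, hi⟩, Finset.mem_univ _,
        h.subsingleton i hi _ _ (hxM ⟨i, hi⟩) hvi (hX (hxX _)) (hX hv)⟩
  simpa using hx.symm

variable [Fintype V] [DecidableEq V] {Y Z L R : Finset V}

/-- A path model for `(B, Y ∪ Z)` can be extended along a linkage between `L ∩ R` and `Z` if
`(L, R)` is a separation of minimum order between `Y` and `Z`. -/
theorem link (h : IsPathModel G B (Y ∪ Z) n M) (hX : Y ∪ Z ⊆ B) (hB : L ∪ R = B)
    (hY : Y ⊆ L) (hZ : Z ⊆ R)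
    (hLR : ∀ u v, u ∉ R → v ∉ L → ¬ (G.restrictTo B \ G.restrictTo (Y ∪ Z)).Adj u v)
    (hmin : ∀ L' R', (G.restrictTo B \ G.restrictTo (Y ∪ Z)).IsSeparation L' R' → Y ⊆ L' →
      Z ⊆ R' → (L ∩ R).card ≤ (L' ∩ R').card) :
    ∃ M, IsPathModel G L (Y ∪ (L ∩ R)) n M := by
  obtain ⟨C, hC⟩ := exists_isLinkage ((G.restrictTo B \ G.restrictTo (Y ∪ Z)).restrictTo R)
    (L ∩ R) Z (L ∩ R).card fun L' R' hL'R' hL' hR' => by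
      refine (hmin (L ∪ L' ∩ R ∪ Bᶜ) (R' ∩ R) ⟨fun v => ?_, fun u v hu hv huv => ?_⟩ ?_ ?_).trans
        (Finset.card_le_card fun v hv => ?_)
      · have := hL'R'.1 v
        grind [Finset.mem_compl]
      · simp only [Finset.mem_union, Finset.mem_inter, Finset.mem_compl, not_or, not_and,
          not_not] at hu hv
        have hvR : v ∈ R := (Finset.mem_union.1 (hB ▸ hv.2)).resolve_left hv.1.1
        by_cases huR : u ∈ R
        · exact hL'R'.2 u v (fun h => hu h huR) (fun h => hv.1.2 h hvR) ⟨huv, huR, hvR⟩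
        · exact hLR u v huR hv.1.1 huv
      · grind
      · grind
      · have := @hL' v
        grind [Finset.mem_compl]
  obtain ⟨e, he⟩ := hC.symm.exists_equiv_right (by simp)
  choose z' hz' using hC.right
  obtain ⟨D, hD, hDdisj, hDS, z, hz⟩ : ∃ D : (L ∩ R : Finset V) → Set V,
      (∀ s, (((G.restrictTo B \ G.restrictTo (Y ∪ Z)).restrictTo R).induce (D s)).Connected) ∧
      (∀ s t v, v ∈ D s → v ∈ D t → s = t) ∧ (∀ s, D s ∩ ↑(L ∩ R) = {(s : V)}) ∧
      ∃ z : (L ∩ R : Finset V) → V, ∀ s, D s ∩ Z = {z s} :=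
    ⟨fun s => C (e.symm s), fun s => hC.connected _,
      fun s t v hs ht => e.symm.injective (hC.eq_of_mem hs ht),
      fun s => by simpa using he (e.symm s), fun s => z' (e.symm s), fun s => hz' _⟩
  have hsD : ∀ s, (s : V) ∈ D s := fun s => (hDS s ▸ rfl : (s : V) ∈ D s ∩ ↑(L ∩ R)).1
  have hzD : ∀ s, z s ∈ D s ∧ z s ∈ Z := fun s => (hz s ▸ rfl : z s ∈ D s ∩ Z)
  have hDR : ∀ s, D s ⊆ R := fun s =>
    subset_of_connected_restrictTo (hD s) (hsD s) (Finset.mem_inter.1 s.2).2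
  have hDL : ∀ s, ∀ v ∈ D s, v ∈ L → v = s := fun s v hv hvL =>
    (hDS s ▸ ⟨hv, Finset.mem_inter.2 ⟨hvL, hDR s hv⟩⟩ : v ∈ ({(s : V)} : Set V))
  have hDZ : ∀ s, ∀ v ∈ D s, v ∈ Z → v = z s := fun s v hv hvZ =>
    (hz s ▸ ⟨hv, hvZ⟩ : v ∈ ({z s} : Set V))
  have hDX : ∀ s : (L ∩ R : Finset V), (s : V) ∉ Y → ∀ v ∈ D s, v ∈ Y ∪ Z → v = z s :=
    fun s hs v hv hvX => by
      obtain hvY | hvZ := Finset.mem_union.1 hvX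
      · exact absurd (hDL s v hv (hY hvY) ▸ hvY) hs
      · exact hDZ s v hv hvZ
  have hDG : ∀ s, (G.induce (D s)).Connected := fun s =>
    (hD s).mono <| SimpleGraph.comap_monotone _ <|
      restrictTo_le.trans (sdiff_le.trans restrictTo_le)
  have hzs : ∀ i < n, ∀ s t, z s ∈ M i → z t ∈ M i → s = t := fun i hi s t hs ht =>
    hDdisj s t (z s) (hzD s).1 <| h.subsingleton i hi _ _ hs ht
      (hX (Finset.mem_union_right _ (hzD s).2)) (hX (Finset.mem_union_right _ (hzD t).2)) ▸
        (hzD t).1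
  let M' : ℕ → Set V := fun i =>
    {v | v ∈ M i ∨ ∃ s : (L ∩ R : Finset V), (s : V) ∉ Y ∧ z s ∈ M i ∧ v ∈ D s}
  have hMR : ∀ i < n, ∀ s : (L ∩ R : Finset V), (s : V) ∉ Y → ∀ v ∈ M i, v ∈ D s → v = z s :=
    fun i hi s hs v hv hvs =>
      hDX s hs v hvs (h.mem i hi v hv (hB ▸ Finset.mem_union_right _ (hDR s hvs)))
  refine ⟨M', fun i hi => ?_, fun i hi j hj v hvi hvj => ?_, fun i hi => ?_,
    fun i hi u v hu hv huL hvL => ?_, fun v hv => ?_, fun i hi v hv hvL => ?_⟩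
  · by_cases hs : ∃ s : (L ∩ R : Finset V), (s : V) ∉ Y ∧ z s ∈ M i
    · obtain ⟨s, hsY, hs⟩ := hs
      have : M' i = M i ∪ D s := Set.ext fun v => or_congr_right
        ⟨fun ⟨t, _, ht, hvt⟩ => hzs i hi s t hs ht ▸ hvt, fun hv => ⟨s, hsY, hs, hv⟩⟩
      rw [this]
      exact induce_union_connected (h.connected i hi).preconnected (hDG s).preconnected
        ⟨z s, hs, (hzD s).1⟩
    · have : M' i = M i := Set.ext fun v =>
        or_iff_left fun ⟨s, hsY, hsM, _⟩ => hs ⟨s, hsY, hsM⟩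
      rw [this]
      exact h.connected i hi
  · have hd := h.disjoint i hi j hj
    obtain hvi | ⟨s, hs, hsi, hvs⟩ := hvi <;> obtain hvj | ⟨t, ht, htj, hvt⟩ := hvj
    · exact hd v hvi hvj
    · exact hd v hvi (hMR i hi t ht v hvi hvt ▸ htj)
    · exact hd v (hMR j hj s hs v hvj hvs ▸ hsi) hvj
    · exact hd _ hsi (hDdisj s t v hvs hvt ▸ htj)
  · obtain ⟨a, ha, b, hb, hab⟩ := h.adj i hi
    exact ⟨a, Or.inl ha, b, Or.inl hb, hab⟩
  · have hs : ∀ u ∈ M i, u ∈ L → ∀ s : (L ∩ R : Finset V), z s ∈ M i → ∀ v ∈ D s, v ∈ L →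
        u = v := fun u hu huL s hs v hv hvL => by
      have huz : u = z s := h.subsingleton i hi _ _ hu hs (hB ▸ Finset.mem_union_left _ huL)
        (hX (Finset.mem_union_right _ (hzD s).2))
      rw [hDL s v hv hvL, hDL s u (huz ▸ (hzD s).1) huL]
    obtain hu | ⟨s, -, hsi, hus⟩ := hu <;> obtain hv | ⟨t, -, hti, hvt⟩ := hv
    · exact h.subsingleton i hi u v hu hv (hB ▸ Finset.mem_union_left _ huL)
        (hB ▸ Finset.mem_union_left _ hvL)
    · exact hs u hu huL t hti v hvt hvL
    · exact (hs v hv hvL s hsi u hus huL).symm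
    · obtain rfl := hzs i hi s t hsi hti
      rw [hDL s u hus huL, hDL s v hvt hvL]
  · by_cases hvY : v ∈ Y
    · obtain ⟨i, hi, hvi⟩ := h.exists_mem v (Finset.mem_union_left _ hvY)
      exact ⟨i, hi, Or.inl hvi⟩
    · let s : (L ∩ R : Finset V) := ⟨v, (Finset.mem_union.1 hv).resolve_left hvY⟩
      obtain ⟨i, hi, hzi⟩ := h.exists_mem (z s) (Finset.mem_union_right _ (hzD s).2)
      exact ⟨i, hi, Or.inr ⟨s, hvY, hzi, hsD s⟩⟩
  · obtain hv | ⟨s, -, -, hvs⟩ := hv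
    · have hvX := h.mem i hi v hv (hB ▸ Finset.mem_union_left _ hvL)
      have := @hZ v
      grind
    · exact Finset.mem_union_right _ (hDL s v hvs hvL ▸ s.2)

end IsPathModel

theorem SimpleGraph.exists_connected_interior {V : Type*} {H : SimpleGraph V} {C : Set V} {y z : V}
    (hC : (H.induce C).Connected) (hy : y ∈ C) (hz : z ∈ C) (hyz : y ≠ z)
    (hadj : ¬ H.Adj y z) :
    ∃ I ⊆ C, y ∉ I ∧ z ∉ I ∧ (H.induce I).Connected ∧ (∃ a ∈ I, H.Adj y a) ∧
      ∃ b ∈ I, H.Adj z b := by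
  classical
  obtain ⟨p, hp, hpC⟩ : ∃ p : H.Walk y z, p.IsPath ∧ ∀ v ∈ p.support, v ∈ C := by
    obtain ⟨p⟩ := hC.preconnected ⟨y, hy⟩ ⟨z, hz⟩
    refine ⟨p.bypass.map (Embedding.induce C).toHom, ?_, fun v hv => ?_⟩
    · exact p.bypass_isPath.map Subtype.val_injective
    · obtain ⟨w, -, rfl⟩ := List.mem_map.1 <|
        (congrArg (v ∈ ·) (p.bypass.support_map (Embedding.induce C).toHom)).mp hv
      exact w.2
  cases p with
  | nil => exact absurd rfl hyz
  | @cons _ a _ hya p =>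
    rw [Walk.cons_isPath_iff] at hp
    obtain ⟨q, hq, hqC, hyq⟩ : ∃ q : H.Walk z a, q.IsPath ∧ (∀ v ∈ q.support, v ∈ C) ∧
        y ∉ q.support :=
      ⟨p.reverse, hp.1.reverse, fun v hv => hpC v (by simp at hv; simp [hv]), by simpa using hp.2⟩
    cases q with
    | nil => exact absurd hya hadj
    | @cons _ b _ hzb q =>
      rw [Walk.cons_isPath_iff] at hq
      exact ⟨{v | v ∈ q.support}, fun v hv => hqC v (by simp_all), fun h => hyq (by simp_all),
        hq.2, q.connected_induce_support, ⟨a, q.end_mem_support, hya⟩,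
        ⟨b, q.start_mem_support, hzb⟩⟩

theorem IsPathModel.exists_isMinor_linkedPath {V : Type*} [DecidableEq V] {G : SimpleGraph V}
    {ℓ : ℕ} {B Y Z : Finset V} {M : ℕ → Set V} {y z : Fin ℓ → V} {C : Fin ℓ → Set V}
    (h : IsPathModel G B (Y ∪ Z) (2 * ℓ) M)
    (hY : ∀ v ∈ Y, ∃ i, y i = v) (hZ : ∀ v ∈ Z, ∃ i, z i = v)
    (hyM : ∀ i : Fin ℓ, y i ∈ M i) (hzM : ∀ i : Fin ℓ, z i ∈ M (ℓ + i))
    (hC : (G.restrictTo B \ G.restrictTo (Y ∪ Z)).IsLinkage Y Z C) :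
    ∃ σ : Fin ℓ ≃ Fin ℓ, IsMinor (linkedPath ℓ σ) G := by
  choose y' hy' using hC.left
  choose z' hz' using hC.right
  have hyC : ∀ j, y' j ∈ C j ∩ Y := fun j => by simp [hy']
  have hzC : ∀ j, z' j ∈ C j ∩ Z := fun j => by simp [hz']
  choose f hf using fun j => hY _ (hyC j).2
  choose g hg using fun j => hZ _ (hzC j).2
  have hfi : f.Injective := fun i j hij =>
    hC.eq_of_mem (hyC i).1 (by rw [← hf, hij, hf]; exact (hyC j).1)
  have hgi : g.Injective := fun i j hij =>
    hC.eq_of_mem (hzC i).1 (by rw [← hg, hij, hg]; exact (hzC j).1)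
  let f' : Fin ℓ ≃ Fin ℓ := Equiv.ofBijective f (Finite.injective_iff_bijective.1 hfi)
  let g' : Fin ℓ ≃ Fin ℓ := Equiv.ofBijective g (Finite.injective_iff_bijective.1 hgi)
  have hI : ∀ j, ∃ I ⊆ C j, y' j ∉ I ∧ z' j ∉ I ∧
      ((G.restrictTo B \ G.restrictTo (Y ∪ Z)).induce I).Connected ∧
      (∃ a ∈ I, (G.restrictTo B \ G.restrictTo (Y ∪ Z)).Adj (y' j) a) ∧
      ∃ b ∈ I, (G.restrictTo B \ G.restrictTo (Y ∪ Z)).Adj (z' j) b := fun j => by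
    refine exists_connected_interior (hC.connected j) (hyC j).1 (hzC j).1 (fun hj => ?_)
      fun hj => hj.2 ⟨hj.1.1, Finset.mem_union_left _ (hyC j).2, Finset.mem_union_right _ (hzC j).2⟩
    have := h.disjoint (f j) (by omega) (ℓ + g j) (by omega) (y' j) (hf j ▸ hyM _)
      (hj ▸ hg j ▸ hzM _)
    omega
  choose I hIC hyI hzI hIconn hya hzb using hI
  have hIB : ∀ j, I j ⊆ B := fun j => by
    obtain ⟨a, ha, hya⟩ := hya j
    exact subset_of_connected_restrictTo
      ((hIconn j).mono <| SimpleGraph.comap_monotone _ sdiff_le) ha hya.1.2.2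
  have hMI : ∀ i < 2 * ℓ, ∀ j, ∀ v ∈ M i, v ∉ I j := fun i hi j v hv hvI => by
    obtain hvY | hvZ := Finset.mem_union.1 (h.mem i hi v hv (hIB j hvI))
    · have : v = y' j := (hy' j ▸ ⟨hIC j hvI, hvY⟩ : v ∈ ({y' j} : Set V))
      exact hyI j (this ▸ hvI)
    · have : v = z' j := (hz' j ▸ ⟨hIC j hvI, hvZ⟩ : v ∈ ({z' j} : Set V))
      exact hzI j (this ▸ hvI)
  let N : Fin (2 * ℓ) ⊕ Fin ℓ → Set V := Sum.elim (fun i => M i) fun j => I (f'.symm j)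
  have hff : ∀ j, f (f'.symm j) = j := f'.apply_symm_apply
  have hpath : ∀ i j : Fin (2 * ℓ), (j : ℕ) = i + 1 → ∃ a ∈ M i, ∃ b ∈ M j, G.Adj a b :=
    fun i j hij => hij ▸ h.adj i (by omega)
  have hlink : ∀ (i : Fin (2 * ℓ)) (j : Fin ℓ),
      ((i : ℕ) = j ∨ (i : ℕ) = ℓ + (f'.symm.trans g' j : Fin ℓ)) →
        ∃ a ∈ M i, ∃ b ∈ I (f'.symm j), G.Adj a b := fun i j hij => by
    obtain hij | hij := hij
    · obtain ⟨a, ha, hya⟩ := hya (f'.symm j)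
      exact ⟨_, by rw [hij, ← hf, hff]; exact hyM j, a, ha, hya.1.1⟩
    · obtain ⟨b, hb, hzb⟩ := hzb (f'.symm j)
      exact ⟨_, by rw [hij, ← hg]; exact hzM _, b, hb, hzb.1.1⟩
  have hsymm : ∀ {s t : Set V}, (∃ a ∈ s, ∃ b ∈ t, G.Adj a b) → ∃ a ∈ t, ∃ b ∈ s, G.Adj a b :=
    fun ⟨a, ha, b, hb, hab⟩ => ⟨b, hb, a, ha, hab.symm⟩
  refine ⟨f'.symm.trans g', N, ?_, ?_, ?_⟩
  · rintro (i | j)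
    · exact h.connected i i.2
    · exact (hIconn _).mono <| SimpleGraph.comap_monotone _ (sdiff_le.trans restrictTo_le)
  · rintro (i | i) (j | j) hij <;> refine Set.disjoint_left.2 fun v hvi hvj => ?_
    · exact hij (congrArg _ (Fin.ext (h.disjoint i i.2 j j.2 v hvi hvj)))
    · exact hMI i i.2 _ v hvi hvj
    · exact hMI j j.2 _ v hvj hvi
    · exact hij (congrArg _ (f'.symm.injective (hC.eq_of_mem (hIC _ hvi) (hIC _ hvj))))
  · rintro (i | i) (j | j) ⟨-, hij | hij⟩
    · exact hpath i j hij
    · exact hsymm (hpath j i hij)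
    · exact hlink i j hij
    · exact hij.elim
    · exact hij.elim
    · exact hsymm (hlink j i hij)
    · exact hij.elim
    · exact hij.elim

section

variable {V : Type*} [DecidableEq V] {G : SimpleGraph V} {B X Y Z L R : Finset V}
  {n k ℓ : ℕ} {M : ℕ → Set V}

theorem HasRootedTreeDecomp.of_separation (hX : Y ∪ Z ⊆ B) (hB : L ∪ R = B) (hY : Y ⊆ L)
    (hZ : Z ⊆ R) (hLR : ∀ u v, u ∉ R → v ∉ L → ¬ (G.restrictTo B \ G.restrictTo (Y ∪ Z)).Adj u v)
    (hk : (Y ∪ Z ∪ (L ∩ R)).card ≤ k) (hL : HasRootedTreeDecomp G k L (Y ∪ (L ∩ R)))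
    (hR : HasRootedTreeDecomp G k R (Z ∪ (L ∩ R))) :
    HasRootedTreeDecomp G k B (Y ∪ Z) := by
  have hadj : ∀ u v, u ∉ R → v ∉ L → u ∈ B → v ∈ B → (u ∉ Y ∪ Z ∨ v ∉ Y ∪ Z) → ¬ G.Adj u v :=
    fun u v hu hv huB hvB huv hadj =>
      hLR u v hu hv ⟨⟨hadj, huB, hvB⟩, fun h => huv.elim (· h.2.1) (· h.2.2)⟩
  have hW : HasRootedTreeDecomp G k (L ∪ (Y ∪ Z ∪ (L ∩ R))) (Y ∪ Z ∪ (L ∩ R)) :=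
    hL.glue (.of_card_le hk) (by grind) (by grind)
      fun u hu v hv => hadj u v (by grind) (by grind) (by grind) (by grind) (by grind)
  have := hR.glue hW (by grind) (by grind)
    fun u hu v hv huv => hadj v u (by grind) (by grind) (by grind) (by grind) (by grind) huv.symm
  rw [show R ∪ (L ∪ (Y ∪ Z ∪ L ∩ R)) = B by grind] at this
  exact this.anti Finset.subset_union_left

variable [Fintype V]

theorem IsPathModel.exists_ssubset (h : IsPathModel G B (Y ∪ Z) n M) (hX : Y ∪ Z ⊆ B)
    (hB : L ∪ R = B) (hY : Y ⊆ L) (hZ : Z ⊆ R)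
    (hLR : ∀ u v, u ∉ R → v ∉ L → ¬ (G.restrictTo B \ G.restrictTo (Y ∪ Z)).Adj u v)
    (hmin : ∀ L' R', (G.restrictTo B \ G.restrictTo (Y ∪ Z)).IsSeparation L' R' → Y ⊆ L' →
      Z ⊆ R' → (L ∩ R).card ≤ (L' ∩ R').card)
    (hcard : (L ∩ R).card < Z.card)
    (hL : ¬ HasRootedTreeDecomp G k L (Y ∪ (L ∩ R))) :
    ∃ B' ⊂ B, ∃ X' ⊆ B', X'.card ≤ Y.card + Z.card ∧ ¬ HasRootedTreeDecomp G k B' X' ∧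
      ∃ n M, IsPathModel G B' X' n M := by
  refine ⟨L, ?_, Y ∪ (L ∩ R), by grind, ?_, hL, n, h.link hX hB hY hZ hLR hmin⟩
  · obtain ⟨z, hz, hzS⟩ := Finset.exists_mem_notMem_of_card_lt_card hcard
    refine (Finset.ssubset_iff_of_subset (hB ▸ Finset.subset_union_left)).2 ⟨z, ?_, ?_⟩ <;> grind
  · have := Finset.card_union_le Y (L ∩ R)
    omega

theorem IsPathModel.exists_ssubset_or_isMinor (h : IsPathModel G B X n M) (hX : X ⊆ B)
    (hcard : X.card = 2 * ℓ) (hdec : ¬ HasRootedTreeDecomp G (3 * ℓ - 1) B X) :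
    (∃ B' ⊂ B, ∃ X' ⊆ B', X'.card ≤ 2 * ℓ ∧ ¬ HasRootedTreeDecomp G (3 * ℓ - 1) B' X' ∧
      ∃ n M, IsPathModel G B' X' n M) ∨
    ∃ σ : Fin ℓ ≃ Fin ℓ, IsMinor (linkedPath ℓ σ) G := by
  obtain ⟨n, M, h, hM⟩ := h.exists_forall_mem
  obtain rfl : 2 * ℓ = n := hcard.symm.trans (h.card_eq hX hM)
  choose y hyX hyM using fun i : Fin ℓ => hM i (by omega)
  choose z hzX hzM using fun i : Fin ℓ => hM (ℓ + i) (by omega)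
  obtain ⟨Y, hYdef⟩ : ∃ Y, Y = Finset.univ.image y := ⟨_, rfl⟩
  obtain ⟨Z, hZdef⟩ : ∃ Z, Z = Finset.univ.image z := ⟨_, rfl⟩
  have hYℓ : Y.card ≤ ℓ := by
    simpa [hYdef] using Finset.card_image_le (s := Finset.univ) (f := y)
  have hZℓ : Z.card ≤ ℓ := by
    simpa [hZdef] using Finset.card_image_le (s := Finset.univ) (f := z)
  obtain rfl : X = Y ∪ Z := by
    ext v
    simp only [hYdef, hZdef, Finset.mem_union, Finset.mem_image, Finset.mem_univ, true_and]
    refine ⟨fun hv => ?_, fun hv => ?_⟩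
    · obtain ⟨i, hi, hvi⟩ := h.exists_mem v hv
      by_cases hiℓ : i < ℓ
      · exact Or.inl ⟨⟨i, hiℓ⟩, h.subsingleton i hi _ _ (hyM ⟨i, hiℓ⟩) hvi (hX (hyX _)) (hX hv)⟩
      · have hi' : ℓ + (i - ℓ) = i := by omega
        exact Or.inr ⟨⟨i - ℓ, by omega⟩, h.subsingleton i hi _ _
          (by simpa only [hi'] using hzM ⟨i - ℓ, by omega⟩) hvi (hX (hzX _)) (hX hv)⟩
    · obtain ⟨i, rfl⟩ | ⟨i, rfl⟩ := hv
      exacts [hyX i, hzX i]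
  have hYZ := Finset.card_union_le Y Z
  obtain ⟨⟨L, R⟩, ⟨hLR, hYL, hZR⟩, hmin⟩ := Set.exists_min_image
    {p : Finset V × Finset V | (G.restrictTo B \ G.restrictTo (Y ∪ Z)).IsSeparation p.1 p.2 ∧
      Y ⊆ p.1 ∧ Z ⊆ p.2} (fun p => (p.1 ∩ p.2).card) (Set.toFinite _)
    ⟨(Finset.univ, Finset.univ), by simp [IsSeparation]⟩
  by_cases hℓ : ℓ ≤ (L ∩ R).card
  · obtain ⟨C, hC⟩ := exists_isLinkage (G.restrictTo B \ G.restrictTo (Y ∪ Z)) Y Z ℓ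
      fun L' R' hLR' hL' hR' => hℓ.trans (hmin (L', R') ⟨hLR', hL', hR'⟩)
    exact Or.inr <| h.exists_isMinor_linkedPath (by simp [hYdef]) (by simp [hZdef]) hyM hzM hC
  left
  have hS : ((L ∩ B) ∩ (R ∩ B)).card ≤ (L ∩ R).card := Finset.card_le_card (by grind)
  have hB : L ∩ B ∪ R ∩ B = B := by
    ext v
    have := hLR.1 v
    grind
  have hYL' : Y ⊆ L ∩ B := by grind
  have hZR' : Z ⊆ R ∩ B := by grind
  have hLR' : ∀ u v, u ∉ R ∩ B → v ∉ L ∩ B →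
      ¬ (G.restrictTo B \ G.restrictTo (Y ∪ Z)).Adj u v := fun u v hu hv huv =>
    hLR.2 u v (fun h => hu (Finset.mem_inter.2 ⟨h, huv.1.2.1⟩))
      (fun h => hv (Finset.mem_inter.2 ⟨h, huv.1.2.2⟩)) huv
  by_cases hL : HasRootedTreeDecomp G (3 * ℓ - 1) (L ∩ B) (Y ∪ (L ∩ B) ∩ (R ∩ B))
  · have hR : ¬ HasRootedTreeDecomp G (3 * ℓ - 1) (R ∩ B) (Z ∪ (R ∩ B) ∩ (L ∩ B)) := fun hR => by
      rw [Finset.inter_comm (R ∩ B)] at hR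
      refine hdec (.of_separation hX hB hYL' hZR' hLR' ?_ hL hR)
      have := Finset.card_union_le (Y ∪ Z) ((L ∩ B) ∩ (R ∩ B))
      omega
    rw [Finset.union_comm Y] at h hX hLR' hmin
    obtain ⟨B', hB', X', hX', hcard', h'⟩ := h.exists_ssubset hX (by rw [Finset.union_comm, hB])
      hZR' hYL' (fun u v hu hv huv => hLR' v u hv hu huv.symm) (fun L' R' hLR₁ hL' hR' => by
        rw [Finset.inter_comm, Finset.inter_comm L']
        exact hS.trans (hmin (R', L') ⟨hLR₁.symm, hR', hL'⟩)) (by rw [Finset.inter_comm]; omega) hR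
    exact ⟨B', hB', X', hX', by omega, h'⟩
  · obtain ⟨B', hB', X', hX', hcard', h'⟩ := h.exists_ssubset hX hB hYL' hZR' hLR'
      (fun L' R' hLR₁ hL' hR' => hS.trans (hmin (L', R') ⟨hLR₁, hL', hR'⟩)) (by omega) hL
    exact ⟨B', hB', X', hX', by omega, h'⟩

theorem IsPathModel.exists_isMinor (hℓ : 0 < ℓ) (h : IsPathModel G B X n M) (hX : X ⊆ B)
    (hcard : X.card ≤ 2 * ℓ) (hdec : ¬ HasRootedTreeDecomp G (3 * ℓ - 1) B X) :
    ∃ σ : Fin ℓ ≃ Fin ℓ, IsMinor (linkedPath ℓ σ) G := by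
  induction hN : B.card * (2 * ℓ + 1) + (2 * ℓ - X.card) using Nat.strong_induction_on
    generalizing B X n M with
  | _ N ih =>
    subst hN
    have hlt : ∀ {B' X' : Finset V}, B' ⊂ B → B'.card * (2 * ℓ + 1) + (2 * ℓ - X'.card) <
        B.card * (2 * ℓ + 1) + (2 * ℓ - X.card) := fun hB' => by
      have := Nat.mul_le_mul_right (2 * ℓ + 1) (Nat.succ_le_of_lt (Finset.card_lt_card hB'))
      rw [Nat.succ_mul] at this
      omega
    obtain hcard | hcard := hcard.eq_or_lt
    · obtain ⟨B', hB', X', hX', hcard', hdec', n, M, h'⟩ | h :=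
        h.exists_ssubset_or_isMinor hX hcard hdec
      · exact ih _ (hlt hB') h' hX' hcard' hdec' rfl
      · exact h
    obtain rfl | hXne := X.eq_empty_or_nonempty
    · obtain ⟨v, hv⟩ : B.Nonempty := Finset.nonempty_iff_ne_empty.2 fun hB => by
        subst hB
        exact hdec (.of_card_le (Nat.zero_le _))
      refine ih _ ?_ (IsPathModel.singleton v) (Finset.singleton_subset_iff.2 hv) (by simp; omega)
        (fun hd => hdec (hd.anti (Finset.empty_subset _))) rfl
      simp at hcard ⊢
      omega
    obtain ⟨m, x, hxX, hxm, h⟩ := h.exists_last hXne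
    by_cases hx : ∃ v ∈ B, v ∉ X ∧ G.Adj x v
    · obtain ⟨v, hvB, hvX, hxv⟩ := hx
      refine ih _ ?_ (h.snoc hxm hvB hvX hxv) (Finset.insert_subset hvB hX) ?_
        (fun hd => hdec (hd.anti (Finset.subset_insert v X))) rfl <;>
      rw [Finset.card_insert_of_notMem hvX] <;> omega
    · push Not at hx
      refine ih _ (hlt (Finset.erase_ssubset (hX hxX))) (h.erase x)
        (Finset.erase_subset_erase x hX) ((Finset.card_erase_le).trans hcard.le) (fun hd => ?_) rfl
      have := hd.glue (.of_card_le (show X.card ≤ 3 * ℓ - 1 by omega)) (by grind) (by grind)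
        fun u hu v hv huv => hx u (by grind) (by grind) (by
          have : v = x := by grind
          exact this ▸ huv.symm)
      rw [show B.erase x ∪ X = B by grind] at this
      exact hdec this

end

/-- If `ℓ > 0` and `tw(G) ≥ 3ℓ - 1` then `G` contains as a minor a path on `2ℓ`
vertices together with `ℓ` pairwise disjoint paths of length 2, each joining a vertex
of the first half of the path to a vertex of its second half, every vertex of the
path being the endpoint of exactly one of them. -/
theorem linkedPath_minor_of_treewidth {V : Type*} [Fintype V] (ℓ : ℕ) (hℓ : 0 < ℓ)
    (G : SimpleGraph V) (htw : treewidth G ≥ 3 * ℓ - 1) :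
    ∃ σ : Fin ℓ ≃ Fin ℓ, IsMinor (linkedPath ℓ σ) G := by
  classical
  have h : IsPathModel G Finset.univ ∅ 0 fun _ => ∅ :=
    ⟨by simp, by simp, by simp, by simp, by simp, by simp⟩
  refine h.exists_isMinor hℓ (Finset.empty_subset _) (by simp) fun hd => ?_
  obtain ⟨k, hk⟩ : ∃ k, 3 * ℓ - 1 = k + 1 := ⟨3 * ℓ - 2, by omega⟩
  rw [hk] at hd htw
  exact absurd hd.treewidth_le (by omega)
end
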